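/- Let d ≥ 2 and 0 < α < d, and let P be a simple point process on ℝ^d satisfying Assumptions (A1) and (A2). Then there exists C < ∞ such that for every i ∈ {1,2,3}, P-a.s. for all sufficiently large L, the Poincaré constant satisfies γ^i(L) ≤ C·L². -/

import Mathlib

open MeasureTheory Filter
open scoped ENNReal

noncomputable section

abbrev Pt (d : ℕ) := EuclideanSpace ℝ (Fin d)
abbrev Config (d : ℕ) := Set (Pt d)

def IsLocallyFinite {d : ℕ} (ξ : Config d) : Prop :=
  ∀ A : Set (Pt d), Bornology.IsBounded A → (ξ ∩ A).Finite

instance configMS (d : ℕ) : MeasurableSpace (Config d) :=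
  MeasurableSpace.generateFrom
    { E | ∃ (A : Set (Pt d)) (n : ℕ), Bornology.IsBounded A ∧ MeasurableSet A ∧
        E = {ξ : Config d | (ξ ∩ A).ncard = n} }

def IsPointProcess {d : ℕ} (P : Measure (Config d)) : Prop :=
  IsProbabilityMeasure P ∧ ∀ᵐ ξ ∂P, IsLocallyFinite ξ

def cube (d : ℕ) (L : ℝ) : Set (Pt d) := {p | ∀ i, |p i| ≤ L / 2}

/-- The cube `B_x = Kx + [0,K)^d`. -/
def Kcube (d : ℕ) (K : ℝ) (x : Fin d → ℤ) : Set (Pt d) :=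
  {p | ∀ i, K * x i ≤ p i ∧ p i < K * x i + K}

/-- Bernoulli(p) i.i.d. field on `ℤ^d`, characterized by its cylinder probabilities. -/
def IsBernoulliField (d : ℕ) (p : ℝ) (ν : Measure ((Fin d → ℤ) → Bool)) : Prop :=
  IsProbabilityMeasure ν ∧
  ∀ (S : Finset (Fin d → ℤ)) (b : (Fin d → ℤ) → Bool),
    ν {ω | ∀ x ∈ S, ω x = b x} = ∏ x ∈ S, ENNReal.ofReal (if b x then p else 1 - p)

/-- Assumption (A1): for every p < 1 there is K such that the good-box field
dominates an i.i.d. Bernoulli(p) field, in the sense of a monotone coupling. -/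
def AssumptionA1 {d : ℕ} (P : Measure (Config d)) : Prop :=
  ∀ p : ℝ, 0 < p → p < 1 → ∃ K : ℝ, 0 < K ∧
    ∃ (μ : Measure (Config d × ((Fin d → ℤ) → Bool))) (ν : Measure ((Fin d → ℤ) → Bool)),
      IsProbabilityMeasure μ ∧ IsBernoulliField d p ν ∧
      μ.map Prod.fst = P ∧ μ.map Prod.snd = ν ∧
      ∀ᵐ ω ∂μ, ∀ x : Fin d → ℤ, ω.2 x = true → (ω.1 ∩ Kcube d K x).Nonempty

/-- `R_A(ξ) = Σ_{x ∈ ξ∩A} Σ_{y ∈ ξ} exp(-|x-y|^α)` (valued in `ℝ≥0∞`). -/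
def Rfun {d : ℕ} (α : ℝ) (A : Set (Pt d)) (ξ : Config d) : ℝ≥0∞ :=
  ∑' (x : ↥(ξ ∩ A)) (y : ↥ξ), ENNReal.ofReal (Real.exp (-(dist (x : Pt d) (y : Pt d)) ^ α))

/-- The cube `V_x = L^ε x + [0, L^ε)^d`. -/
def Vcube (d : ℕ) (L : ℕ) (ε : ℝ) (x : Fin d → ℤ) : Set (Pt d) :=
  {p | ∀ i, (L : ℝ) ^ ε * x i ≤ p i ∧ p i < (L : ℝ) ^ ε * x i + (L : ℝ) ^ ε}

/-- Assumption (A2). -/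
def AssumptionA2 {d : ℕ} (α : ℝ) (P : Measure (Config d)) : Prop :=
  ∀ ε : ℝ, 0 < ε → ε < 1 → ∃ C : ℝ, 0 < C ∧
    ∀ᵐ ξ ∂P, ∀ᶠ L : ℕ in atTop,
      ∀ x : Fin d → ℤ, (Vcube d L ε x ∩ cube d L).Nonempty →
        Rfun α (Vcube d L ε x) ξ ≤ ENNReal.ofReal (C * (L : ℝ) ^ (ε * d))

noncomputable instance {d : ℕ} : DecidableEq (Pt d) := Classical.decEq _

variable {d : ℕ}

/-- jump rate `e^{-|x-y|^α}`. -/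
def rate (α : ℝ) (x y : Pt d) : ℝ := Real.exp (-(dist x y) ^ α)

/-- weights `w^i_x` for the three models `i = 1,2,3`. -/
def wgt (α : ℝ) (E : Finset (Pt d)) (i : ℕ) (x : Pt d) : ℝ :=
  if i = 1 then 1
  else if i = 2 then ∑ z ∈ E.erase x, rate α x z
  else max 1 (∑ z ∈ E.erase x, rate α x z)

/-- `W^i(U) = Σ_{x∈U} w^i_x`. -/
def Wsum (α : ℝ) (E : Finset (Pt d)) (i : ℕ) (U : Finset (Pt d)) : ℝ :=
  ∑ x ∈ U, wgt α E i x

/-- the reversible probability measure `ν^i(x) = w^i_x / W^i(ξ_L)`. -/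
def nu (α : ℝ) (E : Finset (Pt d)) (i : ℕ) (x : Pt d) : ℝ :=
  wgt α E i x / Wsum α E i E

/-- conductance `I^i_U`. -/
def conduct (α : ℝ) (E : Finset (Pt d)) (i : ℕ) (U : Finset (Pt d)) : ℝ :=
  (∑ x ∈ U, ∑ y ∈ E \ U, rate α x y) / Wsum α E i U

/-- isoperimetric profile `φ^i_L(t)` (valued in `ℝ≥0∞`; `∞` if no admissible `U`). -/
def isoProfile (α : ℝ) (E : Finset (Pt d)) (i : ℕ) (t : ℝ) : ℝ≥0∞ :=
  ⨅ (U : Finset (Pt d)) (_ : U ⊆ E) (_ : U.Nonempty)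
    (_ : Wsum α E i U ≤ t * Wsum α E i E), ENNReal.ofReal (conduct α E i U)

/-- Cheeger's constant `Φ^i_L = φ^i_L(1/2)`. -/
def cheeger (α : ℝ) (E : Finset (Pt d)) (i : ℕ) : ℝ≥0∞ := isoProfile α E i (1 / 2)

/-- Dirichlet form `E_i(f)`. -/
def dirichlet (α : ℝ) (E : Finset (Pt d)) (i : ℕ) (f : Pt d → ℝ) : ℝ :=
  (1 / 2) * ∑ x ∈ E, ∑ y ∈ E.erase x,
    nu α E i x * (rate α x y / wgt α E i x) * (f x - f y) ^ 2

/-- variance `Var_i(f) = ν^i(f²) - ν^i(f)²`. -/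
def varNu (α : ℝ) (E : Finset (Pt d)) (i : ℕ) (f : Pt d → ℝ) : ℝ :=
  (∑ x ∈ E, nu α E i x * f x ^ 2) - (∑ x ∈ E, nu α E i x * f x) ^ 2

/-- nonconstant on `E`. -/
def Nonconst (E : Finset (Pt d)) (f : Pt d → ℝ) : Prop := ∃ x ∈ E, ∃ y ∈ E, f x ≠ f y

/-- Poincaré constant `γ^i(L) = sup { Var_i f / E_i f : f nonconstant }`. -/
def gammaP (α : ℝ) (E : Finset (Pt d)) (i : ℕ) : ℝ≥0∞ :=
  ⨆ (f : Pt d → ℝ) (_ : Nonconst E f),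
    ENNReal.ofReal (varNu α E i f / dirichlet α E i f)

/-- the generator `L^i` as a matrix on `E`. -/
def gen (α : ℝ) (E : Finset (Pt d)) (i : ℕ) : Matrix ↥E ↥E ℝ :=
  Matrix.of fun x y =>
    if x = y then -(∑ z ∈ E.erase (x : Pt d), rate α (x : Pt d) z / wgt α E i (x : Pt d))
    else rate α (x : Pt d) (y : Pt d) / wgt α E i (x : Pt d)

/-- heat kernel `H^i_t = exp(t L^i)`, via the exponential series. -/
def heatKernel (α : ℝ) (E : Finset (Pt d)) (i : ℕ) (t : ℝ) (x y : ↥E) : ℝ :=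
  ∑' n : ℕ, t ^ n / (n.factorial : ℝ) * (gen α E i ^ n) x y

/-- uniform mixing time `τ^i(L)` (valued in `ℝ≥0∞`). -/
def mixTime (α : ℝ) (E : Finset (Pt d)) (i : ℕ) : ℝ≥0∞ :=
  ⨅ (t : ℝ) (_ : 0 < t)
    (_ : ∀ x y : ↥E,
      |heatKernel α E i t x y - nu α E i (y : Pt d)| / nu α E i (y : Pt d) ≤ Real.exp (-1)),
    ENNReal.ofReal t

/-- `c₀⁺(U)`: nonnegative, nonconstant, vanishing outside `U`. -/
def c0plus (E U : Finset (Pt d)) (f : Pt d → ℝ) : Prop :=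
  (∀ x ∈ E, 0 ≤ f x) ∧ Nonconst E f ∧ ∀ x ∈ E, x ∉ U → f x = 0

/-- `λ^i(U) = inf { E_i f / Var_i f : f ∈ c₀⁺(U) }`. -/
def lambdaU (α : ℝ) (E : Finset (Pt d)) (i : ℕ) (U : Finset (Pt d)) : ℝ :=
  sInf {r : ℝ | ∃ f : Pt d → ℝ, c0plus E U f ∧ r = dirichlet α E i f / varNu α E i f}

/-- `ν^i_* = min_{x∈E} ν^i(x)`. -/
def nuStar (α : ℝ) (E : Finset (Pt d)) (i : ℕ) : ℝ :=
  sInf (nu α E i '' ↑E)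

/-- `ν^i(U)` for a subset `U`. -/
def nuSet (α : ℝ) (E : Finset (Pt d)) (i : ℕ) (U : Finset (Pt d)) : ℝ :=
  ∑ x ∈ U, nu α E i x

/-- spectral profile `Λ^i(r)`. -/
def specProfile (α : ℝ) (E : Finset (Pt d)) (i : ℕ) (r : ℝ) : ℝ :=
  sInf {l : ℝ | ∃ U : Finset (Pt d), U ⊆ E ∧
    nuStar α E i ≤ nuSet α E i U ∧ nuSet α E i U ≤ r ∧ l = lambdaU α E i U}

/-- hybrid conductance profile `ψ_L(t)`: model-3 conductance, counting constraint. -/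
def hybridProfile (α : ℝ) (E : Finset (Pt d)) (t : ℝ) : ℝ≥0∞ :=
  ⨅ (U : Finset (Pt d)) (_ : U ⊆ E) (_ : U.Nonempty)
    (_ : (U.card : ℝ) ≤ t * (E.card : ℝ)), ENNReal.ofReal (conduct α E 3 U)

/-- The discrete cube `{0, …, n-1}^d`. -/
def grid (d n : ℕ) : Finset (Fin d → ℕ) := Fintype.piFinset fun _ => Finset.range n

lemma mem_grid {n : ℕ} {z : Fin d → ℕ} : z ∈ grid d n ↔ ∀ i, z i < n := by
  simp [grid]

lemma card_grid (d n : ℕ) : (grid d n).card = n ^ d := by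
  simp [grid]

/-- The `u`-th site of the `v`-th cube of side `M`. -/
def site (M : ℕ) (v u : Fin d → ℕ) : Fin d → ℕ := fun i => M * v i + u i

/-- Translation by `t` in direction `k`. -/
def shift (k : Fin d) (t : ℕ) (z : Fin d → ℕ) : Fin d → ℕ := Function.update z k (z k + t)

lemma site_mem_grid {n M : ℕ} {v u : Fin d → ℕ} (hv : v ∈ grid d n) (hu : u ∈ grid d M) :
    site M v u ∈ grid d (n * M) := by
  rw [mem_grid] at *
  intro i
  have h1 := hv i
  have h2 := hu i
  calc M * v i + u i < M * v i + M := by omega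
    _ = (v i + 1) * M := by ring
    _ ≤ n * M := Nat.mul_le_mul_right _ h1

lemma site_div {M : ℕ} {v u : Fin d → ℕ} (hu : u ∈ grid d M) (i : Fin d) :
    site M v u i / M = v i := by
  have h2 := mem_grid.1 hu i
  have hM : 0 < M := by omega
  simp only [site]
  rw [Nat.mul_add_div hM, Nat.div_eq_of_lt h2, add_zero]

lemma site_div_mod (M : ℕ) (z : Fin d → ℕ) :
    site M (fun i => z i / M) (fun i => z i % M) = z := by
  funext i
  exact Nat.div_add_mod (z i) M

lemma div_mem_grid {n M : ℕ} {z : Fin d → ℕ} (hz : z ∈ grid d (n * M)) :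
    (fun i => z i / M) ∈ grid d n := by
  rw [mem_grid] at *
  intro i
  exact Nat.div_lt_of_lt_mul (by rw [mul_comm]; exact hz i)

lemma mod_mem_grid {M : ℕ} (hM : 0 < M) (z : Fin d → ℕ) :
    (fun i => z i % M) ∈ grid d M :=
  mem_grid.2 fun _ => Nat.mod_lt _ hM

lemma site_injective (M : ℕ) (v : Fin d → ℕ) : Function.Injective (site M v) := by
  intro u u' h
  funext i
  have := congrFun h i
  simp only [site] at this
  omega

lemma sum_grid_mul {β : Type*} [AddCommMonoid β] {n M : ℕ} (hM : 0 < M) (g : (Fin d → ℕ) → β) :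
    ∑ z ∈ grid d (n * M), g z = ∑ v ∈ grid d n, ∑ u ∈ grid d M, g (site M v u) := by
  rw [← Finset.sum_product']
  symm
  refine Finset.sum_nbij' (fun p => site M p.1 p.2)
    (fun z => (fun i => z i / M, fun i => z i % M)) ?_ ?_ ?_ ?_ ?_
  · intro p hp
    rw [Finset.mem_product] at hp
    exact site_mem_grid hp.1 hp.2
  · intro z hz
    exact Finset.mem_product.2 ⟨div_mem_grid hz, mod_mem_grid hM z⟩
  · intro p hp
    rw [Finset.mem_product] at hp
    ext i
    · exact site_div hp.2 i
    · simp only [site]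
      rw [Nat.mul_add_mod, Nat.mod_eq_of_lt (mem_grid.1 hp.2 i)]
  · intro z _
    exact site_div_mod M z
  · intro p _
    rfl

lemma shift_injective (k : Fin d) (t : ℕ) : Function.Injective (shift k t) := by
  intro z z' h
  funext i
  have := congrFun h i
  by_cases hi : i = k
  · subst hi
    simpa [shift] using this
  · simpa [shift, hi] using this

lemma shift_shift (k : Fin d) (s t : ℕ) (z : Fin d → ℕ) :
    shift k s (shift k t z) = shift k (t + s) z := by
  simp [shift, add_assoc]

lemma shift_zero (k : Fin d) (z : Fin d → ℕ) : shift k 0 z = z := by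
  simp [shift]

lemma shift_site_self (k : Fin d) (M : ℕ) (v u : Fin d → ℕ) :
    shift k M (site M v u) = site M (shift k 1 v) u := by
  funext i
  by_cases hi : i = k
  · subst hi
    simp [shift, site]
    ring
  · simp [shift, site, hi]

lemma sum_shift_site_le {M : ℕ} (k : Fin d) {t : ℕ} (ht : t ≤ M) (v : Fin d → ℕ)
    {g : (Fin d → ℕ) → ℝ} (hg : ∀ z, 0 ≤ g z) :
    ∑ u ∈ grid d M, g (shift k t (site M v u)) ≤
      ∑ u ∈ grid d M, g (site M v u) + ∑ u ∈ grid d M, g (site M (shift k 1 v) u) := by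
  classical
  rw [← Finset.sum_image (f := g) (g := fun u => shift k t (site M v u))
      (fun a _ b _ h => site_injective M v (shift_injective k t h)),
    ← Finset.sum_image (f := g) (g := site M v) (fun a _ b _ h => site_injective M _ h),
    ← Finset.sum_image (f := g) (g := site M (shift k 1 v))
      (fun a _ b _ h => site_injective M _ h)]
  rw [← Finset.sum_union_inter]
  refine le_trans ?_ (le_add_of_nonneg_right (Finset.sum_nonneg fun z _ => hg z))
  refine Finset.sum_le_sum_of_subset_of_nonneg ?_ fun z _ _ => hg z
  intro z hz
  obtain ⟨u, hu, rfl⟩ := Finset.mem_image.1 hz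
  rw [Finset.mem_union, Finset.mem_image, Finset.mem_image]
  have hu' := mem_grid.1 hu
  by_cases h : u k + t < M
  · refine Or.inl ⟨shift k t u, mem_grid.2 fun i => ?_, ?_⟩
    · by_cases hi : i = k
      · subst hi; simpa [shift] using h
      · simpa [shift, hi] using hu' i
    · funext i
      by_cases hi : i = k
      · subst hi; simp [shift, site, add_assoc]
      · simp [shift, site, hi]
  · refine Or.inr ⟨Function.update u k (u k + t - M), mem_grid.2 fun i => ?_, ?_⟩
    · by_cases hi : i = k
      · subst hi
        have := hu' i
        simp
        omega
      · simpa [hi] using hu' i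
    · funext i
      by_cases hi : i = k
      · subst hi
        simp only [shift, site, Function.update_self]
        have : M * (v i + 1) = M * v i + M := by ring
        omega
      · simp [shift, site, hi]

/-- Modulus of the discrete gradient in direction `k` inside the cube of side `n`. -/
def grad (n : ℕ) (c : (Fin d → ℕ) → ℝ) (k : Fin d) (z : Fin d → ℕ) : ℝ :=
  if z k + 1 < n then |c (shift k 1 z) - c z| else 0

lemma grad_nonneg (n : ℕ) (c : (Fin d → ℕ) → ℝ) (k : Fin d) (z : Fin d → ℕ) :
    0 ≤ grad n c k z := by
  unfold grad; split_ifs <;> positivity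

lemma abs_sub_le_sum_range {n : ℕ} (f : ℕ → ℝ) {a b : ℕ} (ha : a < n) (hb : b < n) :
    |f a - f b| ≤ ∑ t ∈ Finset.range n, if t + 1 < n then |f (t + 1) - f t| else 0 := by
  wlog hab : a ≤ b generalizing a b
  · rw [abs_sub_comm]
    exact this hb ha (by omega)
  rw [abs_sub_comm, ← Finset.sum_Ico_sub f hab]
  refine (Finset.abs_sum_le_sum_abs _ _).trans ?_
  calc ∑ t ∈ Finset.Ico a b, |f (t + 1) - f t|
      = ∑ t ∈ Finset.Ico a b, if t + 1 < n then |f (t + 1) - f t| else 0 := by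
        refine Finset.sum_congr rfl fun t ht => ?_
        rw [Finset.mem_Ico] at ht
        rw [if_pos (by omega)]
    _ ≤ _ := by
        refine Finset.sum_le_sum_of_subset_of_nonneg ?_ ?_
        · intro t ht
          rw [Finset.mem_Ico] at ht
          rw [Finset.mem_range]; omega
        · intro t _ _
          split_ifs <;> positivity

/-- The first `k` coordinates from `y`, the others from `x`. -/
def hybrid (k : ℕ) (x y : Fin d → ℕ) : Fin d → ℕ := fun i => if (i : ℕ) < k then y i else x i

lemma hybrid_mem_grid {n : ℕ} (k : ℕ) {x y : Fin d → ℕ} (hx : x ∈ grid d n) (hy : y ∈ grid d n) :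
    hybrid k x y ∈ grid d n := by
  rw [mem_grid] at *
  intro i
  unfold hybrid
  split_ifs
  · exact hy i
  · exact hx i

lemma abs_sub_le_sum_hybrid {n : ℕ} (c : (Fin d → ℕ) → ℝ) {x y : Fin d → ℕ}
    (hx : x ∈ grid d n) (hy : y ∈ grid d n) :
    |c x - c y| ≤ ∑ k : Fin d, ∑ t ∈ Finset.range n,
      grad n c k (Function.update (hybrid k x y) k t) := by
  have h0 : hybrid 0 x y = x := by funext i; simp [hybrid]
  have hd : hybrid d x y = y := by funext i; simp [hybrid]
  have key : c x - c y = ∑ k ∈ Finset.range d, (c (hybrid k x y) - c (hybrid (k + 1) x y)) := by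
    rw [Finset.sum_range_sub', h0, hd]
  rw [key, Finset.sum_range]
  refine (Finset.abs_sum_le_sum_abs _ _).trans (Finset.sum_le_sum fun k _ => ?_)
  have e1 : hybrid k x y = Function.update (hybrid k x y) k (x k) := by
    funext i
    by_cases hi : i = k
    · subst hi; simp [hybrid]
    · simp [hi]
  have e2 : hybrid (k + 1) x y = Function.update (hybrid k x y) k (y k) := by
    funext i
    by_cases hi : i = k
    · subst hi; simp [hybrid]
    · have : (i : ℕ) < (k : ℕ) + 1 ↔ (i : ℕ) < (k : ℕ) := by
        have : (i : ℕ) ≠ k := fun h => hi (Fin.ext h)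
        omega
      simp [hi, hybrid, this]
  have h := abs_sub_le_sum_range (fun t => c (Function.update (hybrid k x y) k t))
    (mem_grid.1 hx k) (mem_grid.1 hy k)
  rw [← e1, ← e2] at h
  refine h.trans (le_of_eq (Finset.sum_congr rfl fun t _ => ?_))
  simp [grad, shift]

lemma sum_update_le {n : ℕ} (k : Fin d) {z : Fin d → ℕ} (hz : z ∈ grid d n)
    {g : (Fin d → ℕ) → ℝ} (hg : ∀ z, 0 ≤ g z) :
    ∑ t ∈ Finset.range n, g (Function.update z k t) ≤ ∑ u ∈ grid d n, g u := by
  classical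
  rw [← Finset.sum_image (f := g) (g := fun t => Function.update z k t)
    (fun a _ b _ h => Function.update_injective z k h)]
  refine Finset.sum_le_sum_of_subset_of_nonneg ?_ fun z _ _ => hg z
  intro w hw
  obtain ⟨t, ht, rfl⟩ := Finset.mem_image.1 hw
  refine mem_grid.2 fun i => ?_
  by_cases hi : i = k
  · subst hi; simpa using ht
  · simpa [hi] using mem_grid.1 hz i

lemma abs_sub_le_sum_grad {n : ℕ} (c : (Fin d → ℕ) → ℝ) {x y : Fin d → ℕ}
    (hx : x ∈ grid d n) (hy : y ∈ grid d n) :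
    |c x - c y| ≤ ∑ k : Fin d, ∑ u ∈ grid d n, grad n c k u :=
  (abs_sub_le_sum_hybrid c hx hy).trans <| Finset.sum_le_sum fun k _ =>
    sum_update_le k (hybrid_mem_grid k hx hy) (grad_nonneg n c k)

lemma sum_sum_hybrid (n k : ℕ) (g : (Fin d → ℕ) → ℝ) :
    ∑ x ∈ grid d n, ∑ y ∈ grid d n, g (hybrid k x y) = (n : ℝ) ^ d * ∑ x ∈ grid d n, g x := by
  have hh : ∀ x y : Fin d → ℕ, hybrid k (hybrid k x y) (hybrid k y x) = x := by
    intro x y; funext i; unfold hybrid; split_ifs <;> rfl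
  have : ∑ p ∈ grid d n ×ˢ grid d n, g (hybrid k p.1 p.2) =
      ∑ p ∈ grid d n ×ˢ grid d n, g p.1 := by
    refine Finset.sum_nbij' (fun p => (hybrid k p.1 p.2, hybrid k p.2 p.1))
      (fun p => (hybrid k p.1 p.2, hybrid k p.2 p.1)) ?_ ?_ ?_ ?_ ?_
    · intro p hp
      rw [Finset.mem_product] at hp ⊢
      exact ⟨hybrid_mem_grid k hp.1 hp.2, hybrid_mem_grid k hp.2 hp.1⟩
    · intro p hp
      rw [Finset.mem_product] at hp ⊢
      exact ⟨hybrid_mem_grid k hp.1 hp.2, hybrid_mem_grid k hp.2 hp.1⟩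
    · intro p _; simp [hh]
    · intro p _; simp [hh]
    · intro p _; rfl
  rw [Finset.sum_product, Finset.sum_product] at this
  rw [this, Finset.mul_sum]
  refine Finset.sum_congr rfl fun x _ => ?_
  simp only [Finset.sum_const, card_grid, nsmul_eq_mul]
  push_cast
  rfl

lemma sum_sum_update (n : ℕ) (k : Fin d) (g : (Fin d → ℕ) → ℝ) :
    ∑ x ∈ grid d n, ∑ t ∈ Finset.range n, g (Function.update x k t) =
      (n : ℝ) * ∑ x ∈ grid d n, g x := by
  have : ∑ p ∈ grid d n ×ˢ Finset.range n, g (Function.update p.1 k p.2) =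
      ∑ p ∈ grid d n ×ˢ Finset.range n, g p.1 := by
    have hm : ∀ p ∈ grid d n ×ˢ Finset.range n,
        (Function.update p.1 k p.2, p.1 k) ∈ grid d n ×ˢ Finset.range n := by
      intro p hp
      rw [Finset.mem_product] at hp ⊢
      have h1 := mem_grid.1 hp.1
      refine ⟨mem_grid.2 fun i => ?_, Finset.mem_range.2 (h1 k)⟩
      by_cases hi : i = k
      · subst hi; simpa using hp.2
      · simpa [hi] using h1 i
    refine Finset.sum_nbij' (fun p => (Function.update p.1 k p.2, p.1 k))
      (fun p => (Function.update p.1 k p.2, p.1 k)) hm hm ?_ ?_ ?_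
    · intro p _; simp
    · intro p _; simp
    · intro p _; rfl
  rw [Finset.sum_product, Finset.sum_product] at this
  rw [this, Finset.mul_sum]
  refine Finset.sum_congr rfl fun x _ => ?_
  simp

/-- Poincaré inequality on the discrete cube. -/
lemma grid_poincare (n : ℕ) (c : (Fin d → ℕ) → ℝ) :
    ∑ x ∈ grid d n, ∑ y ∈ grid d n, (c x - c y) ^ 2 ≤
      (d : ℝ) * n ^ 2 * n ^ d * ∑ k : Fin d, ∑ x ∈ grid d n, grad n c k x ^ 2 := by
  have h1 : ∀ x ∈ grid d n, ∀ y ∈ grid d n, (c x - c y) ^ 2 ≤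
      (d : ℝ) * ∑ k : Fin d, (n : ℝ) * ∑ t ∈ Finset.range n,
        grad n c k (Function.update (hybrid k x y) k t) ^ 2 := by
    intro x hx y hy
    calc (c x - c y) ^ 2 = |c x - c y| ^ 2 := (sq_abs _).symm
      _ ≤ (∑ k : Fin d, ∑ t ∈ Finset.range n,
            grad n c k (Function.update (hybrid k x y) k t)) ^ 2 :=
          pow_le_pow_left₀ (abs_nonneg _) (abs_sub_le_sum_hybrid c hx hy) 2
      _ ≤ (d : ℝ) * ∑ k : Fin d, (∑ t ∈ Finset.range n,
            grad n c k (Function.update (hybrid k x y) k t)) ^ 2 := by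
          simpa using sq_sum_le_card_mul_sum_sq (s := (Finset.univ : Finset (Fin d)))
            (f := fun k => ∑ t ∈ Finset.range n,
              grad n c k (Function.update (hybrid k x y) k t))
      _ ≤ _ := by
          refine mul_le_mul_of_nonneg_left (Finset.sum_le_sum fun k _ => ?_) (by positivity)
          simpa using sq_sum_le_card_mul_sum_sq (s := Finset.range n)
            (f := fun t => grad n c k (Function.update (hybrid k x y) k t))
  calc _ ≤ ∑ x ∈ grid d n, ∑ y ∈ grid d n, (d : ℝ) * ∑ k : Fin d, (n : ℝ) *
        ∑ t ∈ Finset.range n, grad n c k (Function.update (hybrid k x y) k t) ^ 2 :=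
        Finset.sum_le_sum fun x hx => Finset.sum_le_sum fun y hy => h1 x hx y hy
    _ = (d : ℝ) * ∑ k : Fin d, (n : ℝ) * ∑ x ∈ grid d n, ∑ y ∈ grid d n,
        ∑ t ∈ Finset.range n, grad n c k (Function.update (hybrid k x y) k t) ^ 2 := by
        simp only [← Finset.mul_sum]
        congr 1
        simp_rw [Finset.mul_sum]
        rw [Finset.sum_congr rfl fun x _ => Finset.sum_comm, Finset.sum_comm]
    _ = (d : ℝ) * ∑ k : Fin d, (n : ℝ) * ((n : ℝ) ^ d * ((n : ℝ) *
          ∑ x ∈ grid d n, grad n c k x ^ 2)) := by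
        congr 1
        refine Finset.sum_congr rfl fun k _ => ?_
        rw [sum_sum_hybrid n k (fun z => ∑ t ∈ Finset.range n,
          grad n c k (Function.update z k t) ^ 2), sum_sum_update n k fun z => grad n c k z ^ 2]
    _ = _ := by
        simp only [← Finset.mul_sum]
        ring

lemma sq_sum_le_of_sq_le_mul {ι : Type*} (s : Finset ι) {g κ η : ι → ℝ} {a : ℝ}
    (hg : ∀ i ∈ s, 0 ≤ g i) (hκ : ∀ i ∈ s, 0 ≤ κ i) (hη : ∀ i ∈ s, 0 ≤ η i)
    (h : ∀ i ∈ s, g i ^ 2 ≤ κ i * η i) (ha : ∑ i ∈ s, κ i ≤ a) :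
    (∑ i ∈ s, g i) ^ 2 ≤ a * ∑ i ∈ s, η i := by
  have h1 : ∑ i ∈ s, g i ≤ ∑ i ∈ s, √(κ i) * √(η i) := by
    refine Finset.sum_le_sum fun i hi => ?_
    rw [← Real.sqrt_mul (hκ i hi)]
    exact Real.le_sqrt_of_sq_le (h i hi)
  calc (∑ i ∈ s, g i) ^ 2 ≤ (∑ i ∈ s, √(κ i) * √(η i)) ^ 2 :=
        pow_le_pow_left₀ (Finset.sum_nonneg hg) h1 2
    _ ≤ (∑ i ∈ s, √(κ i) ^ 2) * ∑ i ∈ s, √(η i) ^ 2 := Finset.sum_mul_sq_le_sq_mul_sq _ _ _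
    _ = (∑ i ∈ s, κ i) * ∑ i ∈ s, η i := by
        rw [Finset.sum_congr rfl fun i hi => Real.sq_sqrt (hκ i hi),
          Finset.sum_congr rfl fun i hi => Real.sq_sqrt (hη i hi)]
    _ ≤ _ := mul_le_mul_of_nonneg_right ha (Finset.sum_nonneg hη)

/-- Average of `F` over the `v`-th cube of side `M`. -/
def blockAvg (M : ℕ) (F : (Fin d → ℕ) → ℝ) (v : Fin d → ℕ) : ℝ :=
  ((M : ℝ) ^ d)⁻¹ * ∑ u ∈ grid d M, F (site M v u)

lemma grad_site_le {n M : ℕ} {v : Fin d → ℕ} (hv : v ∈ grid d n) (F : (Fin d → ℕ) → ℝ)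
    (k : Fin d) {u : Fin d → ℕ} (hu : u ∈ grid d M) :
    grad M (fun u => F (site M v u)) k u ≤ grad (n * M) F k (site M v u) := by
  unfold grad
  by_cases h : u k + 1 < M
  · have h2 : site M v u k + 1 < n * M := by
      have hw := site_mem_grid (u := shift k 1 u) hv (mem_grid.2 fun i => by
        by_cases hi : i = k
        · subst hi; simpa [shift] using h
        · simpa [shift, hi] using mem_grid.1 hu i)
      have := mem_grid.1 hw k
      simp only [site, shift, Function.update_self] at this ⊢
      omega
    rw [if_pos h, if_pos h2]
    have : shift k 1 (site M v u) = site M v (shift k 1 u) := by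
      funext i
      by_cases hi : i = k
      · subst hi; simp [shift, site, add_assoc]
      · simp [shift, site, hi]
    rw [this]
  · rw [if_neg h]
    split_ifs <;> positivity

lemma sq_sub_blockAvg_le {n M : ℕ} (hM : 0 < M) (F : (Fin d → ℕ) → ℝ)
    {v : Fin d → ℕ} (hv : v ∈ grid d n) {u : Fin d → ℕ} (hu : u ∈ grid d M) :
    |F (site M v u) - blockAvg M F v| ≤
      ∑ k : Fin d, ∑ u ∈ grid d M, grad (n * M) F k (site M v u) := by
  set G := ∑ k : Fin d, ∑ u ∈ grid d M, grad (n * M) F k (site M v u) with hG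
  have h1 : ∀ u' ∈ grid d M, |F (site M v u) - F (site M v u')| ≤ G := fun u' hu' =>
    (abs_sub_le_sum_grad (fun u => F (site M v u)) hu hu').trans <|
      Finset.sum_le_sum fun k _ => Finset.sum_le_sum fun w hw => grad_site_le hv F k hw
  have hMd : (0 : ℝ) < (M : ℝ) ^ d := by positivity
  have h2 : F (site M v u) - blockAvg M F v =
      ((M : ℝ) ^ d)⁻¹ * ∑ u' ∈ grid d M, (F (site M v u) - F (site M v u')) := by
    rw [Finset.sum_sub_distrib, Finset.sum_const, card_grid, nsmul_eq_mul, mul_sub, blockAvg]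
    push_cast
    rw [inv_mul_cancel_left₀ hMd.ne']
  rw [h2, abs_mul, abs_of_pos (inv_pos.2 hMd), inv_mul_le_iff₀ hMd]
  refine (Finset.abs_sum_le_sum_abs _ _).trans ((Finset.sum_le_sum h1).trans (le_of_eq ?_))
  rw [Finset.sum_const, card_grid, nsmul_eq_mul]
  push_cast
  rfl

lemma shift_mem_grid {n : ℕ} {v : Fin d → ℕ} (hv : v ∈ grid d n) {k : Fin d} {t : ℕ}
    (h : v k + t < n) : shift k t v ∈ grid d n := by
  refine mem_grid.2 fun i => ?_
  by_cases hi : i = k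
  · subst hi; simpa [shift] using h
  · simpa [shift, hi] using mem_grid.1 hv i

lemma abs_blockAvg_sub_le {n M : ℕ} (hM : 0 < M) (F : (Fin d → ℕ) → ℝ)
    {v : Fin d → ℕ} {k : Fin d} (hvk : v k + 1 < n) :
    |blockAvg M F (shift k 1 v) - blockAvg M F v| ≤ ((M : ℝ) ^ d)⁻¹ * (M *
      (∑ u ∈ grid d M, grad (n * M) F k (site M v u) +
        ∑ u ∈ grid d M, grad (n * M) F k (site M (shift k 1 v) u))) := by
  have hMd : (0 : ℝ) < (M : ℝ) ^ d := by positivity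
  rw [blockAvg, blockAvg, ← mul_sub, ← Finset.sum_sub_distrib, abs_mul,
    abs_of_pos (inv_pos.2 hMd)]
  refine mul_le_mul_of_nonneg_left ?_ (inv_pos.2 hMd).le
  refine (Finset.abs_sum_le_sum_abs _ _).trans ?_
  have h1 : ∀ u ∈ grid d M, |F (site M (shift k 1 v) u) - F (site M v u)| ≤
      ∑ t ∈ Finset.range M, grad (n * M) F k (shift k t (site M v u)) := by
    intro u hu
    have h2 : F (site M (shift k 1 v) u) - F (site M v u) = ∑ t ∈ Finset.range M,
        (F (shift k (t + 1) (site M v u)) - F (shift k t (site M v u))) := by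
      rw [Finset.sum_range_sub (fun t => F (shift k t (site M v u))), shift_zero,
        shift_site_self]
    rw [h2]
    refine (Finset.abs_sum_le_sum_abs _ _).trans (Finset.sum_le_sum fun t ht => ?_)
    rw [grad, shift_shift, if_pos]
    have h3 := mem_grid.1 hu k
    rw [Finset.mem_range] at ht
    simp only [shift, site, Function.update_self]
    calc M * v k + u k + t + 1 < M * v k + M + M := by omega
      _ = (v k + 2) * M := by ring
      _ ≤ n * M := Nat.mul_le_mul_right _ (by omega)
  refine (Finset.sum_le_sum h1).trans ?_
  rw [Finset.sum_comm]
  calc _ ≤ ∑ t ∈ Finset.range M, (∑ u ∈ grid d M, grad (n * M) F k (site M v u) +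
        ∑ u ∈ grid d M, grad (n * M) F k (site M (shift k 1 v) u)) :=
        Finset.sum_le_sum fun t ht =>
          sum_shift_site_le k (Finset.mem_range.1 ht).le v (grad_nonneg _ _ _)
    _ = _ := by simp [mul_add]

/-- Poincaré inequality at two scales, for conductances whose inverses are bounded on average
over mesoscopic cubes. -/
lemma two_scale_poincare {n M : ℕ} (hn : 0 < n) (hM : 0 < M) (F : (Fin d → ℕ) → ℝ)
    (κ η : Fin d → (Fin d → ℕ) → ℝ) (hκ0 : ∀ k w, 0 ≤ κ k w) (hη0 : ∀ k w, 0 ≤ η k w)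
    {A : ℝ} (hF : ∀ w ∈ grid d (n * M), ∀ k, grad (n * M) F k w ^ 2 ≤ κ k w * η k w)
    (hκ : ∀ v ∈ grid d n, ∀ k, ∑ u ∈ grid d M, κ k (site M v u) ≤ A * M ^ d) :
    ∃ (c : (Fin d → ℕ) → ℝ) (c₀ : ℝ),
      (∀ v ∈ grid d n, ∀ u ∈ grid d M, (F (site M v u) - c v) ^ 2 ≤
        d * A * M ^ d * ∑ k, ∑ u ∈ grid d M, η k (site M v u)) ∧
      M ^ d * ∑ v ∈ grid d n, (c v - c₀) ^ 2 ≤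
        4 * d * A * n ^ 2 * M ^ 2 * ∑ k, ∑ w ∈ grid d (n * M), η k w := by
  have hMd : (0 : ℝ) < (M : ℝ) ^ d := by positivity
  have hnd : (0 : ℝ) < (n : ℝ) ^ d := by positivity
  have hloc : ∀ v ∈ grid d n, ∀ k, (∑ u ∈ grid d M, grad (n * M) F k (site M v u)) ^ 2 ≤
      A * M ^ d * ∑ u ∈ grid d M, η k (site M v u) := fun v hv k =>
    sq_sum_le_of_sq_le_mul _ (fun _ _ => grad_nonneg _ _ _ _) (fun _ _ => hκ0 _ _)
      (fun _ _ => hη0 _ _) (fun u hu => hF _ (site_mem_grid hv hu) k) (hκ v hv k)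
  refine ⟨blockAvg M F, ((n : ℝ) ^ d)⁻¹ * ∑ v ∈ grid d n, blockAvg M F v, ?_, ?_⟩
  · intro v hv u hu
    rw [← sq_abs]
    refine (pow_le_pow_left₀ (abs_nonneg _) (sq_sub_blockAvg_le hM F hv hu) 2).trans ?_
    refine (sq_sum_le_card_mul_sum_sq).trans ?_
    rw [Finset.card_univ, Fintype.card_fin, mul_assoc, mul_assoc, ← mul_assoc A]
    refine mul_le_mul_of_nonneg_left ?_ (by positivity)
    rw [Finset.mul_sum]
    exact Finset.sum_le_sum fun k _ => hloc v hv k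
  · set c := blockAvg M F with hc
    have hA : 0 ≤ A * M ^ d ∨ IsEmpty (Fin d) := by
      by_cases hd0 : IsEmpty (Fin d)
      · exact Or.inr hd0
      · rw [not_isEmpty_iff] at hd0
        obtain ⟨k⟩ := hd0
        exact Or.inl (le_trans (Finset.sum_nonneg fun _ _ => hκ0 _ _)
          (hκ (fun _ => 0) (mem_grid.2 fun _ => hn) k))
    have hjen : ∀ v ∈ grid d n, (c v - ((n : ℝ) ^ d)⁻¹ * ∑ v ∈ grid d n, c v) ^ 2 ≤
        ((n : ℝ) ^ d)⁻¹ * ∑ v' ∈ grid d n, (c v - c v') ^ 2 := by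
      intro v _
      have h2 : c v - ((n : ℝ) ^ d)⁻¹ * ∑ v ∈ grid d n, c v =
          ((n : ℝ) ^ d)⁻¹ * ∑ v' ∈ grid d n, (c v - c v') := by
        rw [Finset.sum_sub_distrib, Finset.sum_const, card_grid, nsmul_eq_mul, mul_sub]
        push_cast
        rw [inv_mul_cancel_left₀ hnd.ne']
      have h3 := sq_sum_le_card_mul_sum_sq (s := grid d n) (f := fun v' => c v - c v')
      rw [card_grid] at h3
      push_cast at h3
      rw [h2, mul_pow]
      calc (((n : ℝ) ^ d)⁻¹) ^ 2 * (∑ v' ∈ grid d n, (c v - c v')) ^ 2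
          ≤ (((n : ℝ) ^ d)⁻¹) ^ 2 * ((n : ℝ) ^ d * ∑ v' ∈ grid d n, (c v - c v') ^ 2) :=
            mul_le_mul_of_nonneg_left h3 (by positivity)
        _ = _ := by field_simp
    have hedge : ∀ v ∈ grid d n, ∀ k, (M : ℝ) ^ d * grad n c k v ^ 2 ≤
        2 * A * M ^ 2 * (∑ u ∈ grid d M, η k (site M v u) + if v k + 1 < n then
          ∑ u ∈ grid d M, η k (site M (shift k 1 v) u) else 0) := by
      intro v hv k
      have hA' : 0 ≤ A := by
        rcases hA with h | h
        · exact nonneg_of_mul_nonneg_left h hMd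
        · exact h.elim k
      unfold grad
      by_cases hvk : v k + 1 < n
      · rw [if_pos hvk, if_pos hvk]
        have h1 := abs_blockAvg_sub_le hM F hvk
        have h2 := pow_le_pow_left₀ (abs_nonneg _) h1 2
        have h3 := hloc v hv k
        have h4 := hloc _ (shift_mem_grid hv hvk) k
        rw [← hc] at h2
        set a := ∑ u ∈ grid d M, grad (n * M) F k (site M v u)
        set b := ∑ u ∈ grid d M, grad (n * M) F k (site M (shift k 1 v) u)
        calc _ ≤ (M : ℝ) ^ d * (((M : ℝ) ^ d)⁻¹ * (M * (a + b))) ^ 2 :=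
              mul_le_mul_of_nonneg_left h2 hMd.le
          _ = ((M : ℝ) ^ d)⁻¹ * M ^ 2 * (a + b) ^ 2 := by field_simp
          _ ≤ ((M : ℝ) ^ d)⁻¹ * M ^ 2 * (2 * (a ^ 2 + b ^ 2)) :=
              mul_le_mul_of_nonneg_left (by nlinarith [sq_nonneg (a - b)]) (by positivity)
          _ ≤ ((M : ℝ) ^ d)⁻¹ * M ^ 2 * (2 * (A * M ^ d * ∑ u ∈ grid d M, η k (site M v u) +
                A * M ^ d * ∑ u ∈ grid d M, η k (site M (shift k 1 v) u))) := by
              gcongr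
          _ = _ := by field_simp
      · rw [if_neg hvk, if_neg hvk]
        have : 0 ≤ ∑ u ∈ grid d M, η k (site M v u) := Finset.sum_nonneg fun _ _ => hη0 _ _
        simp only [ne_eq, OfNat.ofNat_ne_zero, not_false_eq_true, zero_pow, mul_zero, add_zero]
        positivity
    have hsum : (M : ℝ) ^ d * ∑ k : Fin d, ∑ v ∈ grid d n, grad n c k v ^ 2 ≤
        4 * A * M ^ 2 * ∑ k, ∑ w ∈ grid d (n * M), η k w := by
      rw [Finset.mul_sum, Finset.mul_sum]
      refine Finset.sum_le_sum fun k _ => ?_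
      have hA' : 0 ≤ A := by
        rcases hA with h | h
        · exact nonneg_of_mul_nonneg_left h hMd
        · exact h.elim k
      rw [Finset.mul_sum, sum_grid_mul hM]
      refine (Finset.sum_le_sum fun v hv => hedge v hv k).trans ?_
      rw [← Finset.mul_sum, Finset.sum_add_distrib]
      have : ∑ v ∈ grid d n, (if v k + 1 < n then
          ∑ u ∈ grid d M, η k (site M (shift k 1 v) u) else 0) ≤
          ∑ v ∈ grid d n, ∑ u ∈ grid d M, η k (site M v u) := by
        classical
        rw [← Finset.sum_filter, ← Finset.sum_image (s := (grid d n).filter fun v => v k + 1 < n)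
          (f := fun v => ∑ u ∈ grid d M, η k (site M v u)) (g := shift k 1)
          (fun a _ b _ h => shift_injective k 1 h)]
        refine Finset.sum_le_sum_of_subset_of_nonneg ?_
          fun _ _ _ => Finset.sum_nonneg fun _ _ => hη0 _ _
        intro w hw
        obtain ⟨v, hv, rfl⟩ := Finset.mem_image.1 hw
        rw [Finset.mem_filter] at hv
        exact shift_mem_grid hv.1 hv.2
      calc _ ≤ 2 * A * M ^ 2 * (∑ v ∈ grid d n, ∑ u ∈ grid d M, η k (site M v u) +
            ∑ v ∈ grid d n, ∑ u ∈ grid d M, η k (site M v u)) := by gcongr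
        _ = _ := by ring
    have hpo := grid_poincare n c
    calc _ ≤ (M : ℝ) ^ d * ∑ v ∈ grid d n, ((n : ℝ) ^ d)⁻¹ * ∑ v' ∈ grid d n, (c v - c v') ^ 2 :=
          mul_le_mul_of_nonneg_left (Finset.sum_le_sum hjen) hMd.le
      _ = (M : ℝ) ^ d * (((n : ℝ) ^ d)⁻¹ * ∑ v ∈ grid d n, ∑ v' ∈ grid d n, (c v - c v') ^ 2) := by
          rw [Finset.mul_sum (grid d n) _ (((n : ℝ) ^ d)⁻¹)]
      _ ≤ (M : ℝ) ^ d * (((n : ℝ) ^ d)⁻¹ * ((d : ℝ) * n ^ 2 * n ^ d *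
            ∑ k : Fin d, ∑ x ∈ grid d n, grad n c k x ^ 2)) := by gcongr
      _ = d * n ^ 2 * ((M : ℝ) ^ d * ∑ k : Fin d, ∑ v ∈ grid d n, grad n c k v ^ 2) := by
          field_simp
      _ ≤ d * n ^ 2 * (4 * A * M ^ 2 * ∑ k, ∑ w ∈ grid d (n * M), η k w) :=
          mul_le_mul_of_nonneg_left hsum (by positivity)
      _ = _ := by ring

/-- Comparison of a weighted variance with the energy `∑ r(x,y) (f x - f y)²` through an anchor
`anc z` for every site `z` of a discrete cube. -/
lemma weighted_poincare {X : Type*} [DecidableEq X] (E : Finset X) (r : X → X → ℝ)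
    (hr : ∀ x y, 0 ≤ r x y) (w : X → ℝ) (hw : ∀ x ∈ E, 0 ≤ w x) (f : X → ℝ)
    {n M : ℕ} (hn : 0 < n) (hM : 0 < M) (cell : X → Fin d → ℕ)
    (hcell : ∀ x ∈ E, cell x ∈ grid d (n * M)) (anc : (Fin d → ℕ) → X)
    (hanc : ∀ z ∈ grid d (n * M), anc z ∈ E) {A B Q Θ : ℝ}
    (hQ : ∀ x ∈ E, 1 ≤ Q * r x (anc (cell x)))
    (hB : ∀ v ∈ grid d n, ∑ x ∈ E with (fun i => cell x i / M) = v, w x ≤ B * M ^ d)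
    (κ : Fin d → (Fin d → ℕ) → ℝ) (hκ0 : ∀ k z, 0 ≤ κ k z)
    (hκ : ∀ v ∈ grid d n, ∀ k, ∑ u ∈ grid d M, κ k (site M v u) ≤ A * M ^ d)
    (θ : (Fin d → ℕ) → ℝ) (hθ0 : ∀ z, 0 ≤ θ z)
    (hκθ : ∀ z ∈ grid d (n * M), ∀ k, z k + 1 < n * M →
      1 ≤ κ k z * (θ z * r (anc z) (anc (shift k 1 z))))
    (hθ : ∀ a ∈ E, ∑ z ∈ grid d (n * M) with anc z = a, θ z ≤ Θ) (hA : 0 ≤ A) (hB0 : 0 ≤ B)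
    (hQ0 : 0 ≤ Q) :
    ∃ c₀ : ℝ, ∑ x ∈ E, w x * (f x - c₀) ^ 2 ≤
      3 * (B * M ^ d * Q + d ^ 2 * A * B * Θ * (M ^ d * M ^ d) +
        4 * d ^ 2 * A * B * Θ * (n * M) ^ 2) * ∑ x ∈ E, ∑ y ∈ E, r x y * (f x - f y) ^ 2 := by
  set D := ∑ x ∈ E, ∑ y ∈ E, r x y * (f x - f y) ^ 2 with hD
  have hD0 : ∀ x ∈ E, ∀ y ∈ E, 0 ≤ r x y * (f x - f y) ^ 2 := fun x _ y _ =>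
    mul_nonneg (hr x y) (sq_nonneg _)
  set F : (Fin d → ℕ) → ℝ := fun z => f (anc z) with hF
  set η : Fin d → (Fin d → ℕ) → ℝ := fun k z => if z k + 1 < n * M then
    θ z * (r (anc z) (anc (shift k 1 z)) * (F z - F (shift k 1 z)) ^ 2) else 0 with hη
  have hη0 : ∀ k z, 0 ≤ η k z := by
    intro k z
    simp only [hη]
    split_ifs
    · exact mul_nonneg (hθ0 z) (mul_nonneg (hr _ _) (sq_nonneg _))
    · exact le_rfl
  have hgrad : ∀ z ∈ grid d (n * M), ∀ k, grad (n * M) F k z ^ 2 ≤ κ k z * η k z := by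
    intro z hz k
    simp only [hη, grad]
    split_ifs with h
    · rw [sq_abs]
      nlinarith [mul_le_mul_of_nonneg_right (hκθ z hz k h)
        (sq_nonneg (F (shift k 1 z) - F z))]
    · simp
  have hηsum : ∑ k, ∑ z ∈ grid d (n * M), η k z ≤ d * Θ * D := by
    have h1 : ∀ k, ∑ z ∈ grid d (n * M), η k z ≤ Θ * D := by
      intro k
      rw [← Finset.sum_fiberwise_of_maps_to hanc, hD, Finset.mul_sum]
      refine Finset.sum_le_sum fun a ha => ?_
      have hDa : 0 ≤ ∑ y ∈ E, r a y * (f a - f y) ^ 2 := Finset.sum_nonneg (hD0 a ha)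
      refine le_trans (Finset.sum_le_sum (g := fun z => θ z * ∑ y ∈ E, r a y * (f a - f y) ^ 2)
        fun z hz => ?_) ?_
      · rw [Finset.mem_filter] at hz
        obtain ⟨hz, rfl⟩ := hz
        simp only [hη]
        split_ifs with h
        · refine mul_le_mul_of_nonneg_left ?_ (hθ0 z)
          exact Finset.single_le_sum (hD0 _ ha) (hanc _ (shift_mem_grid hz h))
        · exact mul_nonneg (hθ0 z) hDa
      · rw [← Finset.sum_mul]
        exact mul_le_mul_of_nonneg_right (hθ a ha) hDa
    refine (Finset.sum_le_sum fun k _ => h1 k).trans (le_of_eq ?_)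
    simp [mul_assoc]
  obtain ⟨c, c₀, hc1, hc2⟩ := two_scale_poincare hn hM F κ η hκ0 hη0 hgrad hκ
  refine ⟨c₀, ?_⟩
  have hv : ∀ x ∈ E, (fun i => cell x i / M) ∈ grid d n := fun x hx => div_mem_grid (hcell x hx)
  have hwB : ∀ x ∈ E, w x ≤ B * M ^ d := by
    intro x hx
    have hm : x ∈ E.filter fun y => (fun i => cell y i / M) = fun i => cell x i / M :=
      Finset.mem_filter.2 ⟨hx, rfl⟩
    exact (Finset.single_le_sum (f := w) (fun y hy => hw y (Finset.mem_filter.1 hy).1) hm).trans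
      (hB _ (hv x hx))
  have t1 : ∑ x ∈ E, w x * (f x - F (cell x)) ^ 2 ≤ B * M ^ d * Q * D := by
    rw [hD, Finset.mul_sum]
    refine Finset.sum_le_sum fun x hx => ?_
    have ha := hanc _ (hcell x hx)
    calc w x * (f x - F (cell x)) ^ 2 ≤ (B * M ^ d) * (f x - F (cell x)) ^ 2 :=
          mul_le_mul_of_nonneg_right (hwB x hx) (sq_nonneg _)
      _ ≤ (B * M ^ d) * ((Q * r x (anc (cell x))) * (f x - F (cell x)) ^ 2) :=
          mul_le_mul_of_nonneg_left (le_mul_of_one_le_left (sq_nonneg _) (hQ x hx))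
            (by positivity)
      _ = B * M ^ d * Q * (r x (anc (cell x)) * (f x - f (anc (cell x))) ^ 2) := by
          simp only [hF]; ring
      _ ≤ _ := mul_le_mul_of_nonneg_left (Finset.single_le_sum (hD0 x hx) ha) (by positivity)
  have t2 : ∑ x ∈ E, w x * (F (cell x) - c fun i => cell x i / M) ^ 2 ≤
      B * M ^ d * (d * A * M ^ d * (d * Θ * D)) := by
    rw [← Finset.sum_fiberwise_of_maps_to hv]
    calc _ ≤ ∑ v ∈ grid d n, B * M ^ d * (d * A * M ^ d *
          ∑ k, ∑ u ∈ grid d M, η k (site M v u)) := by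
          refine Finset.sum_le_sum fun v hvn => ?_
          have hη1 : 0 ≤ ∑ k, ∑ u ∈ grid d M, η k (site M v u) :=
            Finset.sum_nonneg fun _ _ => Finset.sum_nonneg fun _ _ => hη0 _ _
          refine le_trans (Finset.sum_le_sum (g := fun x => w x * (d * A * M ^ d *
            ∑ k, ∑ u ∈ grid d M, η k (site M v u))) fun x hx => ?_) ?_
          · rw [Finset.mem_filter] at hx
            obtain ⟨hx, rfl⟩ := hx
            refine mul_le_mul_of_nonneg_left ?_ (hw x hx)
            have := hc1 _ hvn _ (mod_mem_grid hM (cell x))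
            rwa [site_div_mod] at this
          · rw [← Finset.sum_mul]
            exact mul_le_mul_of_nonneg_right (hB v hvn) (by positivity)
      _ = B * M ^ d * (d * A * M ^ d * ∑ k, ∑ z ∈ grid d (n * M), η k z) := by
          rw [← Finset.mul_sum, ← Finset.mul_sum, Finset.sum_comm]
          simp_rw [sum_grid_mul hM]
      _ ≤ _ := by gcongr
  have t3 : ∑ x ∈ E, w x * ((c fun i => cell x i / M) - c₀) ^ 2 ≤
      B * (4 * d * A * n ^ 2 * M ^ 2 * (d * Θ * D)) := by
    rw [← Finset.sum_fiberwise_of_maps_to hv]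
    calc _ ≤ ∑ v ∈ grid d n, B * M ^ d * (c v - c₀) ^ 2 := by
          refine Finset.sum_le_sum fun v hvn => ?_
          refine le_trans (Finset.sum_le_sum (g := fun x => w x * (c v - c₀) ^ 2)
            fun x hx => ?_) ?_
          · rw [Finset.mem_filter] at hx
            rw [hx.2]
          · rw [← Finset.sum_mul]
            exact mul_le_mul_of_nonneg_right (hB v hvn) (sq_nonneg _)
      _ = B * (M ^ d * ∑ v ∈ grid d n, (c v - c₀) ^ 2) := by
          rw [← Finset.mul_sum]; ring
      _ ≤ B * (4 * d * A * n ^ 2 * M ^ 2 * ∑ k, ∑ w ∈ grid d (n * M), η k w) :=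
          mul_le_mul_of_nonneg_left hc2 hB0
      _ ≤ _ := by gcongr
  calc ∑ x ∈ E, w x * (f x - c₀) ^ 2
      ≤ ∑ x ∈ E, 3 * (w x * (f x - F (cell x)) ^ 2 +
          w x * (F (cell x) - c fun i => cell x i / M) ^ 2 +
          w x * ((c fun i => cell x i / M) - c₀) ^ 2) := by
        refine Finset.sum_le_sum fun x hx => ?_
        rw [← mul_add, ← mul_add, mul_left_comm]
        refine mul_le_mul_of_nonneg_left ?_ (hw x hx)
        generalize f x = a, F (cell x) = b, (c fun i => cell x i / M) = e
        nlinarith [sq_nonneg (a - b - (b - e)), sq_nonneg (a - b - (e - c₀)),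
          sq_nonneg (b - e - (e - c₀))]
    _ = 3 * (∑ x ∈ E, w x * (f x - F (cell x)) ^ 2 +
          ∑ x ∈ E, w x * (F (cell x) - c fun i => cell x i / M) ^ 2 +
          ∑ x ∈ E, w x * ((c fun i => cell x i / M) - c₀) ^ 2) := by
        rw [← Finset.mul_sum, Finset.sum_add_distrib, Finset.sum_add_distrib]
    _ ≤ 3 * (B * M ^ d * Q * D + B * M ^ d * (d * A * M ^ d * (d * Θ * D)) +
          B * (4 * d * A * n ^ 2 * M ^ 2 * (d * Θ * D))) := by gcongr
    _ = _ := by ring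

/-- A weighted Poincaré inequality bounds the Poincaré constants of the three models. -/
lemma gammaP_le_of_forall (α : ℝ) (E : Finset (Pt d)) (i : ℕ)
    {G : ℝ} (hG : 0 ≤ G)
    (h : ∀ f : Pt d → ℝ, ∃ c₀ : ℝ, ∑ x ∈ E, (∑ z ∈ E, rate α x z) * (f x - c₀) ^ 2 ≤
      G * ∑ x ∈ E, ∑ y ∈ E, rate α x y * (f x - f y) ^ 2) (hα : 0 < α) :
    gammaP α E i ≤ ENNReal.ofReal (2 * G) := by
  refine iSup₂_le fun f hf => ENNReal.ofReal_le_ofReal ?_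
  obtain ⟨a, ha, b, hb, hab⟩ := hf
  have hab' : a ≠ b := fun h => hab (by rw [h])
  have hrate : ∀ x y : Pt d, 0 < rate α x y := fun x y => Real.exp_pos _
  have hrate1 : ∀ x : Pt d, rate α x x = 1 := fun x => by
    simp [rate, Real.zero_rpow hα.ne']
  have hsplit : ∀ x ∈ E, ∑ z ∈ E, rate α x z = 1 + ∑ z ∈ E.erase x, rate α x z := by
    intro x hx
    rw [← Finset.add_sum_erase _ _ hx, hrate1]
  have hs0 : ∀ x, 0 ≤ ∑ z ∈ E.erase x, rate α x z := fun x =>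
    Finset.sum_nonneg fun _ _ => (hrate _ _).le
  have hw0 : ∀ x ∈ E, 0 < wgt α E i x := by
    intro x hx
    have hpos : 0 < ∑ z ∈ E.erase x, rate α x z := by
      refine Finset.sum_pos (fun _ _ => hrate _ _) ?_
      by_cases hxa : x = a
      · exact ⟨b, Finset.mem_erase.2 ⟨by rw [hxa]; exact hab'.symm, hb⟩⟩
      · exact ⟨a, Finset.mem_erase.2 ⟨fun h => hxa h.symm, ha⟩⟩
    unfold wgt
    split_ifs
    · exact one_pos
    · exact hpos
    · exact lt_max_of_lt_left one_pos
  have hwle : ∀ x ∈ E, wgt α E i x ≤ ∑ z ∈ E, rate α x z := by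
    intro x hx
    have := hs0 x
    rw [hsplit x hx]
    unfold wgt
    split_ifs
    · linarith
    · linarith
    · exact max_le (by linarith) (by linarith)
  have hW : 0 < Wsum α E i E := Finset.sum_pos hw0 ⟨a, ha⟩
  have hdir : dirichlet α E i f =
      1 / 2 * ((Wsum α E i E)⁻¹ * ∑ x ∈ E, ∑ y ∈ E, rate α x y * (f x - f y) ^ 2) := by
    unfold dirichlet
    congr 1
    rw [Finset.mul_sum]
    refine Finset.sum_congr rfl fun x hx => ?_
    rw [← Finset.add_sum_erase _ _ hx, sub_self]
    simp only [ne_eq, OfNat.ofNat_ne_zero, not_false_eq_true, zero_pow, mul_zero, zero_add]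
    rw [Finset.mul_sum]
    refine Finset.sum_congr rfl fun y _ => ?_
    have := (hw0 x hx).ne'
    unfold nu
    field_simp
  have hnu1 : ∑ x ∈ E, nu α E i x = 1 := by
    unfold nu
    rw [← Finset.sum_div]
    exact div_self hW.ne'
  have hdir0 : 0 ≤ dirichlet α E i f := by
    rw [hdir]
    have : 0 ≤ ∑ x ∈ E, ∑ y ∈ E, rate α x y * (f x - f y) ^ 2 :=
      Finset.sum_nonneg fun x _ => Finset.sum_nonneg fun y _ =>
        mul_nonneg (hrate x y).le (sq_nonneg _)
    positivity
  obtain ⟨c₀, hc⟩ := h f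
  refine div_le_of_le_mul₀ hdir0 (by positivity) ?_
  have hvar : varNu α E i f ≤ ∑ x ∈ E, nu α E i x * (f x - c₀) ^ 2 := by
    have : ∑ x ∈ E, nu α E i x * (f x - c₀) ^ 2 = ∑ x ∈ E, nu α E i x * f x ^ 2 -
        2 * c₀ * ∑ x ∈ E, nu α E i x * f x + c₀ ^ 2 * ∑ x ∈ E, nu α E i x := by
      rw [Finset.mul_sum, Finset.mul_sum, ← Finset.sum_sub_distrib, ← Finset.sum_add_distrib]
      exact Finset.sum_congr rfl fun x _ => by ring
    rw [this, hnu1, varNu]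
    nlinarith [sq_nonneg (∑ x ∈ E, nu α E i x * f x - c₀)]
  refine hvar.trans ?_
  calc ∑ x ∈ E, nu α E i x * (f x - c₀) ^ 2
      = (Wsum α E i E)⁻¹ * ∑ x ∈ E, wgt α E i x * (f x - c₀) ^ 2 := by
        rw [Finset.mul_sum]
        exact Finset.sum_congr rfl fun x _ => by unfold nu; ring
    _ ≤ (Wsum α E i E)⁻¹ * ∑ x ∈ E, (∑ z ∈ E, rate α x z) * (f x - c₀) ^ 2 := by
        refine mul_le_mul_of_nonneg_left (Finset.sum_le_sum fun x hx => ?_) (by positivity)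
        exact mul_le_mul_of_nonneg_right (hwle x hx) (sq_nonneg _)
    _ ≤ (Wsum α E i E)⁻¹ * (G * ∑ x ∈ E, ∑ y ∈ E, rate α x y * (f x - f y) ^ 2) := by gcongr
    _ = 2 * G * dirichlet α E i f := by rw [hdir]; ring

/-- Smallest `k` such that the dyadic cube of side `2^k` containing `z` has a good site. -/
def lev (good : (Fin d → ℕ) → Prop) (z : Fin d → ℕ) : ℕ :=
  sInf {k | ∃ z', good z' ∧ ∀ i, z' i / 2 ^ k = z i / 2 ^ k}

lemma site_site_div {κ k : ℕ} (hk : k ≤ κ) (v b : Fin d → ℕ) {c : Fin d → ℕ}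
    (hc : c ∈ grid d (2 ^ k)) (i : Fin d) :
    site (2 ^ κ) v (site (2 ^ k) b c) i / 2 ^ k = 2 ^ (κ - k) * v i + b i := by
  have hc' := mem_grid.1 hc i
  have h2 : 2 ^ κ = 2 ^ k * 2 ^ (κ - k) := by rw [← pow_add]; congr 1; omega
  have : site (2 ^ κ) v (site (2 ^ k) b c) i = 2 ^ k * (2 ^ (κ - k) * v i + b i) + c i := by
    simp only [site]
    rw [h2]
    ring
  rw [this, Nat.mul_add_div (by positivity), Nat.div_eq_of_lt hc', add_zero]

lemma sum_lev_le {good : (Fin d → ℕ) → Prop} {κ m : ℕ} (hm : m ≤ κ) (v : Fin d → ℕ)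
    (R x : ℕ → ℝ) (hR : ∀ k, 0 ≤ R k)
    (hlev : ∀ u ∈ grid d (2 ^ κ), lev good (site (2 ^ κ) v u) ≤ m)
    (hbad : ∀ k < m, ∀ T ∈ (grid d (2 ^ (κ - k))).powersetCard ⌈x k⌉₊,
      ∃ b ∈ T, ∃ c ∈ grid d (2 ^ k), good (site (2 ^ κ) v (site (2 ^ k) b c))) :
    ∑ u ∈ grid d (2 ^ κ), R (lev good (site (2 ^ κ) v u)) ≤
      (2 ^ κ : ℝ) ^ d * R 0 + ∑ k ∈ Finset.range m, R (k + 1) * ((2 ^ k : ℝ) ^ d * x k) := by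
  classical
  have h1 : ∀ u ∈ grid d (2 ^ κ), R (lev good (site (2 ^ κ) v u)) ≤ R 0 +
      ∑ k ∈ Finset.range m, R (k + 1) * if lev good (site (2 ^ κ) v u) = k + 1 then 1 else 0 := by
    intro u hu
    have hn : ∀ k ∈ Finset.range m,
        0 ≤ R (k + 1) * if lev good (site (2 ^ κ) v u) = k + 1 then (1 : ℝ) else 0 := by
      intro k _
      refine mul_nonneg (hR _) ?_
      split_ifs <;> norm_num
    have hl := hlev u hu
    rcases hcase : lev good (site (2 ^ κ) v u) with _ | j
    · rw [hcase] at hn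
      exact le_add_of_nonneg_right (Finset.sum_nonneg hn)
    · rw [hcase] at hn hl
      refine le_trans ?_ (le_add_of_nonneg_left (hR 0))
      refine le_trans ?_ (Finset.single_le_sum hn (Finset.mem_range.2 (by omega : j < m)))
      simp
  have h2 : ∀ k < m, ∑ u ∈ grid d (2 ^ κ),
      (if lev good (site (2 ^ κ) v u) = k + 1 then (1 : ℝ) else 0) ≤ (2 ^ k : ℝ) ^ d * x k := by
    intro k hk
    set bad := (grid d (2 ^ (κ - k))).filter fun b =>
      ∀ c ∈ grid d (2 ^ k), ¬ good (site (2 ^ κ) v (site (2 ^ k) b c)) with hbaddef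
    have hcard : (bad.card : ℝ) ≤ x k := by
      by_contra hcon
      push Not at hcon
      have hle : ⌈x k⌉₊ ≤ bad.card := Nat.ceil_le.2 hcon.le
      obtain ⟨T, hT, hTc⟩ := Finset.exists_subset_card_eq hle
      obtain ⟨b, hb, c, hc, hg⟩ := hbad k hk T (Finset.mem_powersetCard.2
        ⟨hT.trans (Finset.filter_subset _ _), hTc⟩)
      exact (Finset.mem_filter.1 (hT hb)).2 c hc hg
    have hp : 2 ^ κ = 2 ^ (κ - k) * 2 ^ k := by rw [← pow_add]; congr 1; omega
    have hsum : ∑ u ∈ grid d (2 ^ κ),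
        (if lev good (site (2 ^ κ) v u) = k + 1 then (1 : ℝ) else 0) =
        ∑ b ∈ grid d (2 ^ (κ - k)), ∑ c ∈ grid d (2 ^ k),
          if lev good (site (2 ^ κ) v (site (2 ^ k) b c)) = k + 1 then (1 : ℝ) else 0 := by
      conv_lhs => rw [show grid d (2 ^ κ) = grid d (2 ^ (κ - k) * 2 ^ k) by rw [← hp]]
      exact sum_grid_mul (by positivity) _
    rw [hsum]
    calc _ ≤ ∑ b ∈ grid d (2 ^ (κ - k)), ∑ c ∈ grid d (2 ^ k),
          if b ∈ bad then (1 : ℝ) else 0 := by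
          refine Finset.sum_le_sum fun b hb => Finset.sum_le_sum fun c hc => ?_
          split_ifs with hl hbb
          · exact le_rfl
          · exfalso
            apply hbb
            refine Finset.mem_filter.2 ⟨hb, fun c' hc' hg => ?_⟩
            have : lev good (site (2 ^ κ) v (site (2 ^ k) b c)) ≤ k :=
              Nat.sInf_le ⟨_, hg, fun i => by
                rw [site_site_div (by omega) v b hc', site_site_div (by omega) v b hc]⟩
            omega
          · norm_num
          · exact le_rfl
      _ = (2 ^ k : ℝ) ^ d * bad.card := by
          simp only [Finset.sum_const, card_grid, nsmul_eq_mul]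
          rw [← Finset.mul_sum, Finset.sum_ite_mem, Finset.sum_const, nsmul_eq_mul, mul_one,
            Finset.inter_eq_right.2 (Finset.filter_subset _ _)]
          push_cast
          rfl
      _ ≤ _ := mul_le_mul_of_nonneg_left hcard (by positivity)
  refine (Finset.sum_le_sum h1).trans ?_
  rw [Finset.sum_add_distrib, Finset.sum_const, card_grid, nsmul_eq_mul, Finset.sum_comm]
  push_cast
  refine add_le_add le_rfl (Finset.sum_le_sum fun k hk => ?_)
  rw [← Finset.mul_sum]
  exact mul_le_mul_of_nonneg_left (h2 k (Finset.mem_range.1 hk)) (hR _)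

lemma sum_inv_pow_level_le (hd : 1 ≤ d) (S : Finset (Fin d → ℕ)) (l : (Fin d → ℕ) → ℕ) {m : ℕ}
    (hl : ∀ z ∈ S, l z ≤ m) (y : Fin d → ℕ)
    (hy : ∀ z ∈ S, ∀ i, y i / 2 ^ l z = z i / 2 ^ l z) :
    ∑ z ∈ S, ((4 : ℝ) ^ (d * l z))⁻¹ ≤ 2 := by
  classical
  have hmaps : ∀ z ∈ S, l z ∈ Finset.range (m + 1) := fun z hz =>
    Finset.mem_range.2 (Nat.lt_succ_of_le (hl z hz))
  rw [← Finset.sum_fiberwise_of_maps_to hmaps]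
  have h1 : ∀ k ∈ Finset.range (m + 1),
      ∑ z ∈ S with l z = k, ((4 : ℝ) ^ (d * l z))⁻¹ ≤ (1 / 2 : ℝ) ^ k := by
    intro k _
    have hcard : (S.filter fun z => l z = k).card ≤ (2 ^ k) ^ d := by
      rw [← card_grid]
      refine (Finset.card_le_card (t := (grid d (2 ^ k)).image
        (site (2 ^ k) fun i => y i / 2 ^ k)) ?_).trans Finset.card_image_le
      intro z hz
      rw [Finset.mem_filter] at hz
      refine Finset.mem_image.2 ⟨fun i => z i % 2 ^ k, mod_mem_grid (by positivity) z, ?_⟩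
      have hz' := hy z hz.1
      rw [hz.2] at hz'
      rw [show (fun i => y i / 2 ^ k) = fun i => z i / 2 ^ k from funext hz']
      exact site_div_mod _ z
    calc ∑ z ∈ S with l z = k, ((4 : ℝ) ^ (d * l z))⁻¹
        = ∑ z ∈ S with l z = k, ((4 : ℝ) ^ (d * k))⁻¹ :=
          Finset.sum_congr rfl fun z hz => by rw [(Finset.mem_filter.1 hz).2]
      _ = (S.filter fun z => l z = k).card * ((4 : ℝ) ^ (d * k))⁻¹ := by
          rw [Finset.sum_const, nsmul_eq_mul]
      _ ≤ ((2 : ℝ) ^ k) ^ d * ((4 : ℝ) ^ (d * k))⁻¹ := by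
          refine mul_le_mul_of_nonneg_right ?_ (by positivity)
          exact_mod_cast hcard
      _ = ((1 / 2 : ℝ) ^ k) ^ d := by
          have : (4 : ℝ) ^ (d * k) = ((2 : ℝ) ^ k) ^ d * ((2 : ℝ) ^ k) ^ d := by
            rw [← mul_pow, ← mul_pow, mul_comm d k, pow_mul]; norm_num
          rw [this, one_div, inv_pow, inv_pow]
          field_simp
      _ ≤ (1 / 2 : ℝ) ^ k :=
          pow_le_of_le_one (by positivity) (pow_le_one₀ (by norm_num) (by norm_num)) (by omega)
  refine (Finset.sum_le_sum h1).trans ?_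
  have hs : HasSum (fun n : ℕ => (1 / 2 : ℝ) ^ n) 2 := hasSum_geometric_two
  exact sum_le_hasSum _ (fun _ _ => by positivity) hs

/-- The `z`-th closed cell of side `ℓ` of the box of side `L`. -/
def InCell (L ℓ : ℝ) (z : Fin d → ℕ) (p : Pt d) : Prop :=
  ∀ i, -L / 2 + ℓ * z i ≤ p i ∧ p i ≤ -L / 2 + ℓ * (z i + 1)

/-- Index of a cell of side `ℓ` containing `p`. -/
def cellIdx (L ℓ : ℝ) (N : ℕ) (p : Pt d) : Fin d → ℕ :=
  fun i => min ⌊(p i + L / 2) / ℓ⌋₊ (N - 1)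

/-- Index of a cube `Kcube d K` contained in the `z`-th cell. -/
def boxIdx (L ℓ K : ℝ) (z : Fin d → ℕ) : Fin d → ℤ := fun i => ⌈(-L / 2 + ℓ * z i) / K⌉

lemma cellIdx_mem_grid (L ℓ : ℝ) {N : ℕ} (hN : 0 < N) (p : Pt d) :
    cellIdx L ℓ N p ∈ grid d N :=
  mem_grid.2 fun i => by simp only [cellIdx]; omega

lemma inCell_cellIdx {L ℓ : ℝ} {N : ℕ} (hℓ : 0 < ℓ) (hN : 0 < N) (hL : L = ℓ * N) {p : Pt d}
    (hp : p ∈ cube d L) : InCell L ℓ (cellIdx L ℓ N p) p := by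
  intro i
  have hpi := abs_le.1 (hp i)
  have h0 : 0 ≤ (p i + L / 2) / ℓ := div_nonneg (by linarith) hℓ.le
  have h1 := Nat.floor_le h0
  have h2 := Nat.lt_floor_add_one ((p i + L / 2) / ℓ)
  rw [le_div_iff₀ hℓ] at h1
  rw [div_lt_iff₀ hℓ] at h2
  constructor
  · have h3 : ((cellIdx L ℓ N p i : ℕ) : ℝ) ≤ ⌊(p i + L / 2) / ℓ⌋₊ := by
      exact_mod_cast min_le_left _ _
    nlinarith
  · simp only [cellIdx]
    rcases min_choice ⌊(p i + L / 2) / ℓ⌋₊ (N - 1) with h | h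
    · rw [h]; nlinarith
    · rw [h]
      have : ((N - 1 : ℕ) : ℝ) + 1 = N := by exact_mod_cast Nat.sub_add_cancel hN
      rw [this, ← hL]
      linarith

lemma Kcube_boxIdx {L ℓ K : ℝ} (hK : 0 < K) (hℓ : 2 * K ≤ ℓ) {z : Fin d → ℕ} {p : Pt d}
    (hp : p ∈ Kcube d K (boxIdx L ℓ K z)) (i : Fin d) :
    -L / 2 + ℓ * z i ≤ p i ∧ p i < -L / 2 + ℓ * (z i + 1) := by
  obtain ⟨h1, h2⟩ := hp i
  have h3 := Int.le_ceil ((-L / 2 + ℓ * z i) / K)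
  have h4 := Int.ceil_lt_add_one ((-L / 2 + ℓ * z i) / K)
  rw [div_le_iff₀ hK] at h3
  rw [← sub_lt_iff_lt_add, lt_div_iff₀ hK] at h4
  simp only [boxIdx] at h1 h2
  constructor <;> nlinarith

lemma floor_of_mem_Kcube_boxIdx {L ℓ K : ℝ} (hK : 0 < K) (hℓ : 2 * K ≤ ℓ) {z : Fin d → ℕ}
    {p : Pt d} (hp : p ∈ Kcube d K (boxIdx L ℓ K z)) (i : Fin d) :
    ⌊(p i + L / 2) / ℓ⌋₊ = z i := by
  obtain ⟨h1, h2⟩ := Kcube_boxIdx hK hℓ hp i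
  have hℓ0 : 0 < ℓ := by linarith
  rw [Nat.floor_eq_iff (div_nonneg (by
    have : 0 ≤ ℓ * (z i : ℝ) := by positivity
    linarith) hℓ0.le), le_div_iff₀ hℓ0, div_lt_iff₀ hℓ0]
  constructor <;> nlinarith

lemma inCell_of_mem_Kcube {L ℓ K : ℝ} (hK : 0 < K) (hℓ : 2 * K ≤ ℓ) {z : Fin d → ℕ}
    {p : Pt d} (hp : p ∈ Kcube d K (boxIdx L ℓ K z)) : InCell L ℓ z p := fun i =>
  ⟨(Kcube_boxIdx hK hℓ hp i).1, (Kcube_boxIdx hK hℓ hp i).2.le⟩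

lemma boxIdx_injective {L ℓ K : ℝ} (hK : 0 < K) (hℓ : 2 * K ≤ ℓ) :
    Function.Injective (boxIdx (d := d) L ℓ K) := by
  intro z z' h
  have hp : ∀ x : Fin d → ℤ, (WithLp.toLp 2 (fun i => K * x i) : Pt d) ∈ Kcube d K x :=
    fun x i => ⟨le_rfl, by simp [hK]⟩
  have h1 := floor_of_mem_Kcube_boxIdx hK hℓ (hp (boxIdx L ℓ K z))
  have h2 := floor_of_mem_Kcube_boxIdx hK hℓ (hp (boxIdx L ℓ K z'))
  rw [← h] at h2
  exact funext fun i => (h1 i).symm.trans (h2 i)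

lemma mem_cube_of_inCell {L ℓ : ℝ} {N : ℕ} (hℓ : 0 < ℓ) (hL : L = ℓ * N) {z : Fin d → ℕ}
    (hz : z ∈ grid d N) {p : Pt d} (hp : InCell L ℓ z p) : p ∈ cube d L := by
  intro i
  obtain ⟨h1, h2⟩ := hp i
  have h3 : (z i : ℝ) + 1 ≤ N := by exact_mod_cast mem_grid.1 hz i
  have h4 : 0 ≤ ℓ * (z i : ℝ) := by positivity
  have h5 : ℓ * ((z i : ℝ) + 1) ≤ ℓ * N := mul_le_mul_of_nonneg_left h3 hℓ.le
  rw [abs_le]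
  constructor <;> linarith

lemma dist_le_of_coord {p q : Pt d} {s : ℝ} (hs : 0 ≤ s) (h : ∀ i, |p i - q i| ≤ s) :
    dist p q ≤ d * s := by
  rw [EuclideanSpace.dist_eq]
  refine Real.sqrt_le_iff.2 ⟨by positivity, ?_⟩
  calc ∑ i, dist (p i) (q i) ^ 2 ≤ ∑ _i : Fin d, s ^ 2 := by
        refine Finset.sum_le_sum fun i _ => ?_
        rw [Real.dist_eq]
        exact pow_le_pow_left₀ (abs_nonneg _) (h i) 2
    _ = d * s ^ 2 := by simp
    _ ≤ (d : ℝ) ^ 2 * s ^ 2 := by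
        refine mul_le_mul_of_nonneg_right ?_ (sq_nonneg s)
        have : d ≤ d ^ 2 := Nat.le_self_pow (by norm_num) d
        exact_mod_cast this
    _ = _ := by ring

lemma dist_le_of_inCell {L ℓ : ℝ} (hℓ : 0 < ℓ) {z z' : Fin d → ℕ} {p p' : Pt d}
    (hp : InCell L ℓ z p) (hp' : InCell L ℓ z' p') {m : ℕ}
    (hm : ∀ i, z i + 1 ≤ z' i + m ∧ z' i + 1 ≤ z i + m) : dist p p' ≤ d * (ℓ * m) := by
  refine dist_le_of_coord (by positivity) fun i => ?_
  obtain ⟨h1, h2⟩ := hp i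
  obtain ⟨h3, h4⟩ := hp' i
  have h5 : (z i : ℝ) + 1 ≤ z' i + m := by exact_mod_cast (hm i).1
  have h6 : (z' i : ℝ) + 1 ≤ z i + m := by exact_mod_cast (hm i).2
  rw [abs_le]
  constructor <;> nlinarith

/-- Length weight attached to a site of level `k`. -/
def levCost (d : ℕ) (K α : ℝ) (k : ℕ) : ℝ :=
  Real.exp ((8 * d * K * 2 ^ k) ^ α) * 4 ^ (d * k)

lemma levCost_pos (d : ℕ) (K α : ℝ) (k : ℕ) : 0 < levCost d K α k := by
  unfold levCost; positivity

lemma add_one_le_of_div_eq {a b q : ℕ} (hq : 0 < q) (h : a / q = b / q) : a + 1 ≤ b + q := by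
  have h1 := Nat.div_add_mod a q
  have h2 := Nat.div_add_mod b q
  have h3 := Nat.mod_lt a hq
  rw [h] at h1
  omega

lemma rate_ge {α s : ℝ} (hα : 0 < α) {x y : Pt d} (h : dist x y ≤ s) :
    Real.exp (-s ^ α) ≤ rate α x y :=
  Real.exp_le_exp.2 (neg_le_neg (Real.rpow_le_rpow dist_nonneg h hα.le))

lemma gammaP_le_of_good (hd : 1 ≤ d) {α K L ℓ : ℝ} (hα : 0 < α) (hK : 0 < K) {J κ m : ℕ}
    (hmκ : m ≤ κ) (hκJ : κ ≤ J) (hL : L = ℓ * (2 ^ J : ℕ)) (hℓ1 : 2 * K ≤ ℓ) (hℓ2 : ℓ ≤ 4 * K)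
    (ξ : Config d) (hfin : (ξ ∩ cube d L).Finite) (x : ℕ → ℝ) (i : ℕ) {S B Q : ℝ}
    (hgood : ∀ b ∈ grid d (2 ^ (J - m)), ∃ c ∈ grid d (2 ^ m),
      (ξ ∩ Kcube d K (boxIdx L ℓ K (site (2 ^ m) b c))).Nonempty)
    (hbad : ∀ v ∈ grid d (2 ^ (J - κ)), ∀ k < m,
      ∀ T ∈ (grid d (2 ^ (κ - k))).powersetCard ⌈x k⌉₊, ∃ b ∈ T, ∃ c ∈ grid d (2 ^ k),
        (ξ ∩ Kcube d K (boxIdx L ℓ K (site (2 ^ κ) v (site (2 ^ k) b c)))).Nonempty)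
    (hS : (2 ^ κ : ℝ) ^ d * levCost d K α 0 +
      ∑ k ∈ Finset.range m, levCost d K α (k + 1) * ((2 ^ k : ℝ) ^ d * x k) ≤ S * (2 ^ κ) ^ d)
    (hB : ∀ v ∈ grid d (2 ^ (J - κ)),
      ∑ p ∈ hfin.toFinset with (fun i => cellIdx L ℓ (2 ^ J) p i / 2 ^ κ) = v,
        ∑ q ∈ hfin.toFinset, rate α p q ≤ B * (2 ^ κ) ^ d)
    (hB0 : 0 ≤ B) (hS0 : 0 ≤ S) (hQ : Real.exp ((8 * d * K * 2 ^ m) ^ α) ≤ Q) :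
    gammaP α hfin.toFinset i ≤ ENNReal.ofReal (2 * (3 * (B * (2 ^ κ) ^ d * Q +
      d ^ 2 * (3 * S) * B * 2 * ((2 ^ κ) ^ d * (2 ^ κ) ^ d) +
      4 * d ^ 2 * (3 * S) * B * 2 * (2 ^ J) ^ 2))) := by
  have hℓ0 : 0 < ℓ := by linarith
  have hQ0 : 0 ≤ Q := (Real.exp_pos _).le.trans hQ
  have hN : 2 ^ (J - κ) * 2 ^ κ = 2 ^ J := by rw [← pow_add]; congr 1; omega
  have hN' : 2 ^ (J - m) * 2 ^ m = 2 ^ J := by rw [← pow_add]; congr 1; omega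
  set good : (Fin d → ℕ) → Prop := fun z => (ξ ∩ Kcube d K (boxIdx L ℓ K z)).Nonempty with hgd
  have hlevset : ∀ z ∈ grid d (2 ^ J),
      m ∈ {k | ∃ z', good z' ∧ ∀ i, z' i / 2 ^ k = z i / 2 ^ k} := by
    intro z hz
    rw [← hN'] at hz
    obtain ⟨c, hc, hg⟩ := hgood _ (div_mem_grid hz)
    exact ⟨_, hg, fun i => site_div hc i⟩
  have hlev : ∀ z ∈ grid d (2 ^ J), lev good z ≤ m := fun z hz => Nat.sInf_le (hlevset z hz)
  have hex : ∀ z, ∃ (p : Pt d) (z' : Fin d → ℕ), z ∈ grid d (2 ^ J) → (p ∈ ξ ∧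
      p ∈ Kcube d K (boxIdx L ℓ K z') ∧ ∀ i, z' i / 2 ^ lev good z = z i / 2 ^ lev good z) := by
    intro z
    by_cases hz : z ∈ grid d (2 ^ J)
    · obtain ⟨z', ⟨p, hp1, hp2⟩, hz'⟩ := Nat.sInf_mem ⟨m, hlevset z hz⟩
      exact ⟨p, z', fun _ => ⟨hp1, hp2, hz'⟩⟩
    · exact ⟨0, 0, fun h => absurd h hz⟩
  choose anc ac hac using hex
  have hcell : ∀ z ∈ grid d (2 ^ J), InCell L ℓ (ac z) (anc z) := fun z hz =>
    inCell_of_mem_Kcube hK hℓ1 (hac z hz).2.1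
  have hacgrid : ∀ z ∈ grid d (2 ^ J), ac z ∈ grid d (2 ^ J) := by
    intro z hz
    refine mem_grid.2 fun i => ?_
    have h1 := (hac z hz).2.2 i
    have h2 := mem_grid.1 hz i
    have h3 : 2 ^ J = 2 ^ (J - lev good z) * 2 ^ lev good z := by
      rw [← pow_add]
      congr 1
      have := hlev z hz
      omega
    rw [h3] at h2 ⊢
    rwa [← Nat.div_lt_iff_lt_mul (by positivity), h1, Nat.div_lt_iff_lt_mul (by positivity)]
  have hnear : ∀ z ∈ grid d (2 ^ J), ∀ i,
      ac z i + 1 ≤ z i + 2 ^ lev good z ∧ z i + 1 ≤ ac z i + 2 ^ lev good z := fun z hz i =>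
    ⟨add_one_le_of_div_eq (by positivity) ((hac z hz).2.2 i),
      add_one_le_of_div_eq (by positivity) ((hac z hz).2.2 i).symm⟩
  set ρ : (Fin d → ℕ) → ℝ := fun z =>
    if z ∈ grid d (2 ^ J) then levCost d K α (lev good z) else 0 with hρ
  have hρ0 : ∀ z, 0 ≤ ρ z := by
    intro z
    simp only [hρ]
    split_ifs
    · exact (levCost_pos _ _ _ _).le
    · exact le_rfl
  have hρsum : ∀ v, ∑ u ∈ grid d (2 ^ κ), ρ (site (2 ^ κ) v u) ≤ S * (2 ^ κ) ^ d := by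
    intro v
    by_cases hv : v ∈ grid d (2 ^ (J - κ))
    · have hmem : ∀ u ∈ grid d (2 ^ κ), site (2 ^ κ) v u ∈ grid d (2 ^ J) := fun u hu =>
        hN ▸ site_mem_grid hv hu
      refine le_trans (le_of_eq (Finset.sum_congr rfl fun u hu => ?_)) ((sum_lev_le hmκ v
        (levCost d K α) x (fun k => (levCost_pos _ _ _ _).le)
        (fun u hu => hlev _ (hmem u hu)) (hbad v hv)).trans hS)
      simp only [hρ, if_pos (hmem u hu)]
    · have : ∀ u ∈ grid d (2 ^ κ), ρ (site (2 ^ κ) v u) = 0 := by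
        intro u hu
        refine if_neg fun hmem => hv ?_
        rw [← hN] at hmem
        have := div_mem_grid hmem
        rwa [show (fun i => site (2 ^ κ) v u i / 2 ^ κ) = v from
          funext fun i => site_div hu i] at this
      rw [Finset.sum_eq_zero this]
      positivity
  have hdist2 : ∀ z ∈ grid d (2 ^ J), ∀ k, z k + 1 < 2 ^ J →
      dist (anc z) (anc (shift k 1 z)) ≤
        8 * d * K * 2 ^ max (lev good z) (lev good (shift k 1 z)) := by
    intro z hz k hzk
    have hs : shift k 1 z ∈ grid d (2 ^ J) := shift_mem_grid hz hzk
    refine (dist_le_of_inCell hℓ0 (hcell z hz) (hcell _ hs)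
      (m := 2 ^ lev good z + 2 ^ lev good (shift k 1 z)) fun i => ?_).trans ?_
    · have h1 := hnear z hz i
      have h2 := hnear _ hs i
      have h3 : z i ≤ shift k 1 z i ∧ shift k 1 z i ≤ z i + 1 := by
        by_cases hik : i = k
        · subst hik; simp [shift]
        · simp [shift, hik]
      omega
    · have h1 : (2 : ℝ) ^ lev good z ≤ 2 ^ max (lev good z) (lev good (shift k 1 z)) :=
        pow_le_pow_right₀ (by norm_num) (le_max_left _ _)
      have h2 : (2 : ℝ) ^ lev good (shift k 1 z) ≤
          2 ^ max (lev good z) (lev good (shift k 1 z)) :=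
        pow_le_pow_right₀ (by norm_num) (le_max_right _ _)
      push_cast
      calc (d : ℝ) * (ℓ * (2 ^ lev good z + 2 ^ lev good (shift k 1 z)))
          ≤ d * (4 * K * (2 ^ max (lev good z) (lev good (shift k 1 z)) +
            2 ^ max (lev good z) (lev good (shift k 1 z)))) := by gcongr
        _ = _ := by ring
  have hmain := fun f : Pt d → ℝ => weighted_poincare hfin.toFinset (rate α)
    (fun _ _ => (Real.exp_pos _).le) (fun p => ∑ q ∈ hfin.toFinset, rate α p q)
    (fun p _ => Finset.sum_nonneg fun _ _ => (Real.exp_pos _).le) f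
    (n := 2 ^ (J - κ)) (M := 2 ^ κ) (by positivity) (by positivity) (cellIdx L ℓ (2 ^ J))
    (fun p _ => by rw [hN]; exact cellIdx_mem_grid L ℓ (by positivity) p) anc
    (fun z hz => by
      rw [hN] at hz
      exact hfin.mem_toFinset.2 ⟨(hac z hz).1,
        mem_cube_of_inCell hℓ0 hL (hacgrid z hz) (hcell z hz)⟩)
    (A := 3 * S) (B := B) (Q := Q) (Θ := 2)
    (fun p hp => by
      have hp' : p ∈ cube d L := (hfin.mem_toFinset.1 hp).2
      set z := cellIdx L ℓ (2 ^ J) p with hzdef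
      have hz : z ∈ grid d (2 ^ J) := cellIdx_mem_grid L ℓ (by positivity) p
      have h1 := dist_le_of_inCell hℓ0 (inCell_cellIdx hℓ0 (by positivity) hL hp') (hcell z hz)
        (m := 2 ^ lev good z) fun i => ⟨(hnear z hz i).2, (hnear z hz i).1⟩
      have h2 : (2 : ℝ) ^ lev good z ≤ 2 ^ m := pow_le_pow_right₀ (by norm_num) (hlev z hz)
      have h3 : dist p (anc z) ≤ 8 * d * K * 2 ^ m := by
        refine h1.trans ?_
        push_cast
        calc (d : ℝ) * (ℓ * 2 ^ lev good z) ≤ d * (4 * K * 2 ^ m) := by gcongr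
          _ ≤ 8 * d * K * 2 ^ m := by
            have : 0 ≤ (d : ℝ) * K * 2 ^ m := by positivity
            linarith
      have h4 := rate_ge hα h3
      calc (1 : ℝ) = Real.exp ((8 * d * K * 2 ^ m) ^ α) * Real.exp (-(8 * d * K * 2 ^ m) ^ α) := by
            rw [← Real.exp_add]; simp
        _ ≤ Q * rate α p (anc z) := by gcongr)
    (by push_cast; exact hB)
    (fun k z => ρ z + ρ (shift k 1 z)) (fun k z => add_nonneg (hρ0 _) (hρ0 _))
    (fun v hv k => by
      rw [Finset.sum_add_distrib]
      have h1 := hρsum v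
      have h2 := sum_shift_site_le (M := 2 ^ κ) (t := 1) (v := v) k Nat.one_le_two_pow hρ0
      have h3 := hρsum (shift k 1 v)
      push_cast
      linarith)
    (fun z => ((4 : ℝ) ^ (d * lev good z))⁻¹) (fun z => by positivity)
    (fun z hz k hzk => by
      rw [hN] at hz hzk
      have hs : shift k 1 z ∈ grid d (2 ^ J) := shift_mem_grid hz hzk
      set mx := max (lev good z) (lev good (shift k 1 z)) with hmx
      have h1 := rate_ge hα (hdist2 z hz k hzk)
      rw [← hmx] at h1
      have h2 : levCost d K α mx ≤ ρ z + ρ (shift k 1 z) := by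
        rcases max_choice (lev good z) (lev good (shift k 1 z)) with h | h
        · rw [hmx, h]
          have : ρ z = levCost d K α (lev good z) := if_pos hz
          linarith [hρ0 (shift k 1 z)]
        · rw [hmx, h]
          have : ρ (shift k 1 z) = levCost d K α (lev good (shift k 1 z)) := if_pos hs
          linarith [hρ0 z]
      have h3 : (4 : ℝ) ^ (d * lev good z) ≤ 4 ^ (d * mx) :=
        pow_le_pow_right₀ (by norm_num) (Nat.mul_le_mul_left _ (le_max_left _ _))
      calc (1 : ℝ) ≤ 4 ^ (d * mx) * (4 ^ (d * lev good z))⁻¹ := by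
            rw [← div_eq_mul_inv, one_le_div (by positivity)]; exact h3
        _ = levCost d K α mx * ((4 ^ (d * lev good z))⁻¹ *
              Real.exp (-(8 * d * K * 2 ^ mx) ^ α)) := by
            unfold levCost
            rw [Real.exp_neg]
            field_simp
        _ ≤ _ := by
            have := hρ0 z
            have := hρ0 (shift k 1 z)
            gcongr)
    (fun a _ => by
      rw [hN]
      refine sum_inv_pow_level_le hd _ (lev good) (m := m)
        (fun z hz => hlev z (Finset.mem_filter.1 hz).1) (fun i => ⌊(a i + L / 2) / ℓ⌋₊)
        fun z hz i => ?_
      obtain ⟨hzg, rfl⟩ := Finset.mem_filter.1 hz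
      rw [floor_of_mem_Kcube_boxIdx hK hℓ1 (hac z hzg).2.1 i]
      exact (hac z hzg).2.2 i)
    (by positivity) hB0 hQ0
  refine gammaP_le_of_forall α hfin.toFinset i (by positivity) (fun f => ?_) hα
  have hNr : (2 : ℝ) ^ (J - κ) * 2 ^ κ = 2 ^ J := by exact_mod_cast hN
  have := hmain f
  push_cast at this
  rwa [hNr] at this

lemma sum_le_tsum_subtype {X : Type*} {s : Set X} {F : Finset X} (hF : ∀ p ∈ F, p ∈ s)
    (g : X → ℝ≥0∞) : ∑ p ∈ F, g p ≤ ∑' x : s, g x := by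
  rw [tsum_subtype]
  refine le_trans (le_of_eq (Finset.sum_congr rfl fun p hp => ?_)) (ENNReal.sum_le_tsum F)
  rw [Set.indicator_of_mem (hF p hp)]

lemma sum_rate_le_Rfun (α : ℝ) {A : Set (Pt d)} {ξ : Config d} {F E : Finset (Pt d)}
    (hF : ∀ p ∈ F, p ∈ ξ ∩ A) (hE : ∀ q ∈ E, q ∈ ξ) :
    ENNReal.ofReal (∑ p ∈ F, ∑ q ∈ E, rate α p q) ≤ Rfun α A ξ := by
  have h0 : ∀ p q : Pt d, 0 ≤ rate α p q := fun _ _ => (Real.exp_pos _).le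
  rw [ENNReal.ofReal_sum_of_nonneg fun p _ => Finset.sum_nonneg fun q _ => h0 p q]
  refine le_trans (Finset.sum_le_sum fun p _ => ?_) (sum_le_tsum_subtype hF
    fun p => ∑' y : ξ, ENNReal.ofReal (rate α p y))
  rw [ENNReal.ofReal_sum_of_nonneg fun q _ => h0 p q]
  exact sum_le_tsum_subtype hE fun q => ENNReal.ofReal (rate α p q)

/-- Under (A2) the total weight of the points in a cube of `2 ^ κ` cells is of the order of the
number of its cells. -/
lemma sum_rate_block_le {α K ℓ ε C : ℝ} {L : ℕ} (hL : 0 < L) (hK : 0 < K)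
    {J κ : ℕ} (hLN : (L : ℝ) = ℓ * (2 ^ J : ℕ)) (hℓ : 0 < ℓ)
    (h1 : 2 ^ κ * ℓ ≤ 4 * K * (L : ℝ) ^ ε) (h2 : (L : ℝ) ^ ε ≤ 2 * 2 ^ κ) (hC : 0 ≤ C)
    {ξ : Config d} (hfin : (ξ ∩ cube d L).Finite)
    (hA2 : ∀ x : Fin d → ℤ, (Vcube d L ε x ∩ cube d L).Nonempty →
        Rfun α (Vcube d L ε x) ξ ≤ ENNReal.ofReal (C * (L : ℝ) ^ (ε * d))) (v : Fin d → ℕ) :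
    ∑ p ∈ hfin.toFinset with (fun i => cellIdx L ℓ (2 ^ J) p i / 2 ^ κ) = v,
        ∑ q ∈ hfin.toFinset, rate α p q ≤
      ((⌈4 * K⌉₊ + 2 : ℕ) : ℝ) ^ d * C * 2 ^ d * (2 ^ κ) ^ d := by
  classical
  have hL0 : (0 : ℝ) < L := by exact_mod_cast hL
  set s : ℝ := (L : ℝ) ^ ε with hs
  have hs0 : 0 < s := Real.rpow_pos_of_pos hL0 ε
  set a : Fin d → ℤ := fun i => ⌊(-(L : ℝ) / 2 + 2 ^ κ * ℓ * v i) / s⌋ with ha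
  set idx : Pt d → Fin d → ℤ := fun p i => ⌊p i / s⌋ with hidx
  set T : ℕ := ⌈4 * K⌉₊ with hT
  set I : Finset (Fin d → ℤ) := Fintype.piFinset fun i => Finset.Icc (a i) (a i + (T + 1 : ℕ))
    with hI
  have hcardI : I.card = (T + 2) ^ d := by
    rw [hI, Fintype.card_piFinset]
    simp only [Int.card_Icc]
    rw [Finset.prod_congr rfl (g := fun _ => T + 2) fun i _ => by omega]
    simp
  have hmaps : ∀ p ∈ hfin.toFinset.filter
      (fun p => (fun i => cellIdx L ℓ (2 ^ J) p i / 2 ^ κ) = v), idx p ∈ I := by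
    intro p hp
    obtain ⟨hpE, rfl⟩ := Finset.mem_filter.1 hp
    have hc := inCell_cellIdx hℓ (N := 2 ^ J) (by positivity) hLN (hfin.mem_toFinset.1 hpE).2
    refine Fintype.mem_piFinset.2 fun i => Finset.mem_Icc.2 ?_
    obtain ⟨hc1, hc2⟩ := hc i
    set c := cellIdx (L : ℝ) ℓ (2 ^ J) p i with hcdef
    have hd1 : (2 : ℝ) ^ κ * ((c / 2 ^ κ : ℕ) : ℝ) ≤ c := by
      exact_mod_cast Nat.mul_div_le c (2 ^ κ)
    have hd2 : (c : ℝ) + 1 ≤ 2 ^ κ * (((c / 2 ^ κ : ℕ) : ℝ) + 1) := by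
      have : c < 2 ^ κ * (c / 2 ^ κ + 1) := Nat.lt_mul_div_succ c (by positivity)
      exact_mod_cast this
    have hlo : -(L : ℝ) / 2 + 2 ^ κ * ℓ * ((c / 2 ^ κ : ℕ) : ℝ) ≤ p i := by
      have := mul_le_mul_of_nonneg_left hd1 hℓ.le
      linarith
    have hhi : p i ≤ -(L : ℝ) / 2 + 2 ^ κ * ℓ * ((c / 2 ^ κ : ℕ) : ℝ) + 4 * K * s := by
      have := mul_le_mul_of_nonneg_left hd2 hℓ.le
      linarith
    constructor
    · exact Int.floor_le_floor (div_le_div_of_nonneg_right hlo hs0.le)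
    · have h3 := div_le_div_of_nonneg_right hhi hs0.le
      rw [add_div _ (4 * K * s), mul_div_cancel_right₀ _ hs0.ne'] at h3
      have h4 := Int.lt_floor_add_one ((-(L : ℝ) / 2 + 2 ^ κ * ℓ * ((c / 2 ^ κ : ℕ) : ℝ)) / s)
      have h5 : 4 * K ≤ T := Nat.le_ceil _
      have h6 : p i / s < ((a i + (T + 1 : ℕ) : ℤ) : ℝ) := by
        push_cast
        simp only [ha]
        linarith
      exact (Int.floor_lt.2 h6).le
  rw [← Finset.sum_fiberwise_of_maps_to hmaps]
  have hfib : ∀ y ∈ I, ∑ p ∈ hfin.toFinset.filter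
      (fun p => (fun i => cellIdx L ℓ (2 ^ J) p i / 2 ^ κ) = v) with idx p = y,
        ∑ q ∈ hfin.toFinset, rate α p q ≤ C * s ^ d := by
    intro y _
    set Fy := (hfin.toFinset.filter
      (fun p => (fun i => cellIdx L ℓ (2 ^ J) p i / 2 ^ κ) = v)).filter fun p => idx p = y
    have hFy : ∀ p ∈ Fy, p ∈ ξ ∧ p ∈ cube d L ∧ p ∈ Vcube d L ε y := by
      intro p hp
      obtain ⟨hpE, rfl⟩ := Finset.mem_filter.1 hp
      have hp' := hfin.mem_toFinset.1 (Finset.mem_filter.1 hpE).1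
      refine ⟨hp'.1, hp'.2, fun i => ?_⟩
      have h3 := Int.floor_le (p i / s)
      have h4 := Int.lt_floor_add_one (p i / s)
      rw [le_div_iff₀ hs0] at h3
      rw [div_lt_iff₀ hs0] at h4
      constructor
      · rw [mul_comm]; exact h3
      · calc p i < (⌊p i / s⌋ + 1) * s := h4
          _ = _ := by simp only [hidx]; ring
    rcases Fy.eq_empty_or_nonempty with he | ⟨p, hp⟩
    · rw [he, Finset.sum_empty]; positivity
    · have h3 := (sum_rate_le_Rfun α (fun p hp => ⟨(hFy p hp).1, (hFy p hp).2.2⟩)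
        fun q hq => (hfin.mem_toFinset.1 hq).1 :
          ENNReal.ofReal (∑ p ∈ Fy, ∑ q ∈ hfin.toFinset, rate α p q) ≤ _).trans
        (hA2 y ⟨p, (hFy p hp).2.2, (hFy p hp).2.1⟩)
      rw [Real.rpow_mul hL0.le, Real.rpow_natCast] at h3
      exact (ENNReal.ofReal_le_ofReal_iff (by positivity)).1 h3
  refine (Finset.sum_le_sum hfib).trans ?_
  rw [Finset.sum_const, hcardI, nsmul_eq_mul]
  push_cast
  calc ((T : ℝ) + 2) ^ d * (C * s ^ d) ≤ ((T : ℝ) + 2) ^ d * (C * (2 * 2 ^ κ) ^ d) := by gcongr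
    _ = _ := by rw [mul_pow]; ring

lemma measurableSet_Kcube (K : ℝ) (x : Fin d → ℤ) : MeasurableSet (Kcube d K x) := by
  have : Kcube d K x = ⋂ i, {p : Pt d | K * x i ≤ p i ∧ p i < K * x i + K} := by
    ext p; simp [Kcube]
  rw [this]
  refine MeasurableSet.iInter fun i => ?_
  have hm : Measurable fun p : Pt d => p i := (EuclideanSpace.proj (𝕜 := ℝ) i).continuous.measurable
  exact (measurableSet_le measurable_const hm).inter (measurableSet_lt hm measurable_const)

lemma isBounded_Kcube {K : ℝ} (hK : 0 < K) (x : Fin d → ℤ) :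
    Bornology.IsBounded (Kcube d K x) := by
  refine Metric.isBounded_iff.2 ⟨d * K, fun p hp q hq => dist_le_of_coord hK.le fun i => ?_⟩
  have h1 := hp i
  have h2 := hq i
  rw [abs_le]
  constructor <;> linarith

/-- Borel–Cantelli for the field of nonempty cubes: eventually every set of a summable family
contains a nonempty cube. -/
lemma ae_eventually_exists_nonempty {P : Measure (Config d)} (hP : IsPointProcess P) {K : ℝ}
    (hK : 0 < K) {μ : Measure (Config d × ((Fin d → ℤ) → Bool))}
    {ν : Measure ((Fin d → ℤ) → Bool)} (hν : IsBernoulliField d (1 - Real.exp (-1)) ν)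
    (hfst : μ.map Prod.fst = P) (hsnd : μ.map Prod.snd = ν)
    (hμ : ∀ᵐ ω ∂μ, ∀ x : Fin d → ℤ, ω.2 x = true → (ω.1 ∩ Kcube d K x).Nonempty)
    {ι : Type*} (I : ℕ → Finset ι) (S : ℕ → ι → Finset (Fin d → ℤ))
    (hsum : ∑' L, ∑ i ∈ I L, ENNReal.ofReal (Real.exp (-(S L i).card)) ≠ ⊤) :
    ∀ᵐ ξ ∂P, ∀ᶠ L in atTop, ∀ i ∈ I L, ∃ x ∈ S L i, (ξ ∩ Kcube d K x).Nonempty := by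
  have hcyl : ∀ T : Finset (Fin d → ℤ), ν {ω | ∀ x ∈ T, ω x = false} =
      ENNReal.ofReal (Real.exp (-T.card)) := by
    intro T
    have := hν.2 T fun _ => false
    simp only [Bool.false_eq_true, if_false, sub_sub_cancel, Finset.prod_const] at this
    rw [this, ← ENNReal.ofReal_pow (Real.exp_pos _).le, ← Real.exp_nat_mul]
    congr 2
    ring
  have hbc : ∀ᵐ ω ∂ν, ∀ᶠ L in atTop, ∀ i ∈ I L, ∃ x ∈ S L i, ω x = true := by
    have hle : ∀ L, ν {ω | ∃ i ∈ I L, ∀ x ∈ S L i, ω x = false} ≤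
        ∑ i ∈ I L, ENNReal.ofReal (Real.exp (-(S L i).card)) := by
      intro L
      have : {ω : (Fin d → ℤ) → Bool | ∃ i ∈ I L, ∀ x ∈ S L i, ω x = false} =
          ⋃ i ∈ I L, {ω | ∀ x ∈ S L i, ω x = false} := by ext; simp
      rw [this]
      refine (measure_biUnion_finset_le _ _).trans (le_of_eq ?_)
      exact Finset.sum_congr rfl fun i _ => hcyl _
    have h0 := ae_eventually_notMem (μ := ν)
      (s := fun L => {ω | ∃ i ∈ I L, ∀ x ∈ S L i, ω x = false})
      (ne_top_of_le_ne_top hsum (ENNReal.tsum_le_tsum hle))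
    filter_upwards [h0] with ω hω
    filter_upwards [hω] with L hL i hi
    by_contra hcon
    push Not at hcon
    exact hL ⟨i, hi, fun x hx => by simpa using hcon x hx⟩
  have hμ2 : ∀ᵐ ω ∂μ, ∀ᶠ L in atTop, ∀ i ∈ I L, ∃ x ∈ S L i, ω.2 x = true :=
    ae_of_ae_map measurable_snd.aemeasurable (by rw [hsnd]; exact hbc)
  have hlf : ∀ᵐ ω ∂μ, IsLocallyFinite ω.1 :=
    ae_of_ae_map measurable_fst.aemeasurable (by rw [hfst]; exact hP.2)
  have hncard : ∀ᵐ ω ∂μ, ∀ᶠ L in atTop, ∀ i ∈ I L, ∃ x ∈ S L i,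
      (ω.1 ∩ Kcube d K x).ncard ≠ 0 := by
    filter_upwards [hμ, hμ2, hlf] with ω h1 h2 h3
    filter_upwards [h2] with L hL i hi
    obtain ⟨x, hx, hωx⟩ := hL i hi
    exact ⟨x, hx, (Set.ncard_pos (h3 _ (isBounded_Kcube hK x))).2 (h1 x hωx) |>.ne'⟩
  have hmeas1 : ∀ x, MeasurableSet {ξ : Config d | (ξ ∩ Kcube d K x).ncard ≠ 0} := fun x =>
    (MeasurableSpace.measurableSet_generateFrom
      ⟨_, 0, isBounded_Kcube hK x, measurableSet_Kcube K x, rfl⟩ :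
      MeasurableSet {ξ : Config d | (ξ ∩ Kcube d K x).ncard = 0}).compl
  have hmeas : MeasurableSet {ξ : Config d | ∀ᶠ L in atTop, ∀ i ∈ I L, ∃ x ∈ S L i,
      (ξ ∩ Kcube d K x).ncard ≠ 0} := by
    have : {ξ : Config d | ∀ᶠ L in atTop, ∀ i ∈ I L, ∃ x ∈ S L i,
        (ξ ∩ Kcube d K x).ncard ≠ 0} = ⋃ N : ℕ, ⋂ L : ℕ, ⋂ _ : N ≤ L, ⋂ i ∈ I L, ⋃ x ∈ S L i,
          {ξ : Config d | (ξ ∩ Kcube d K x).ncard ≠ 0} := by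
      ext
      simp [eventually_atTop]
    rw [this]
    exact MeasurableSet.iUnion fun N => MeasurableSet.iInter fun L => MeasurableSet.iInter fun _ =>
      Finset.measurableSet_biInter _ fun i _ =>
        Finset.measurableSet_biUnion _ fun x _ => hmeas1 x
  have hP' : ∀ᵐ ξ ∂P, ∀ᶠ L in atTop, ∀ i ∈ I L, ∃ x ∈ S L i,
      (ξ ∩ Kcube d K x).ncard ≠ 0 := by
    rw [← hfst]
    exact (ae_map_iff measurable_fst.aemeasurable hmeas).2 hncard
  filter_upwards [hP'] with ξ hξ
  filter_upwards [hξ] with L hL i hi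
  obtain ⟨x, hx, hn⟩ := hL i hi
  exact ⟨x, hx, Set.nonempty_of_ncard_ne_zero hn⟩

lemma pow_log_floor {y : ℝ} (hy : 1 ≤ y) :
    (2 : ℝ) ^ Nat.log 2 ⌊y⌋₊ ≤ y ∧ y ≤ 2 * 2 ^ Nat.log 2 ⌊y⌋₊ := by
  have h0 : ⌊y⌋₊ ≠ 0 := (Nat.floor_pos.2 hy).ne'
  constructor
  · refine le_trans ?_ (Nat.floor_le (by linarith))
    exact_mod_cast Nat.pow_log_le_self 2 h0
  · refine (Nat.lt_floor_add_one y).le.trans ?_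
    have : ⌊y⌋₊ + 1 ≤ 2 ^ (Nat.log 2 ⌊y⌋₊ + 1) := Nat.lt_pow_succ_log_self (by norm_num) _
    rw [pow_succ, mul_comm] at this
    exact_mod_cast this

lemma le_pow_clog_ceil (y : ℝ) {b : ℕ} (hb : 1 < b) : y ≤ (b : ℝ) ^ Nat.clog b ⌈y⌉₊ := by
  refine (Nat.le_ceil y).trans ?_
  exact_mod_cast Nat.le_pow_clog hb _

lemma pow_le_of_lt_clog_ceil {y : ℝ} (hy : 0 ≤ y) {b k : ℕ} (hk : k < Nat.clog b ⌈y⌉₊) :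
    (b : ℝ) ^ k ≤ y + 1 := by
  refine le_trans ?_ (Nat.ceil_lt_add_one hy).le
  exact_mod_cast (Nat.pow_lt_of_lt_clog hk).le

lemma pow_clog_ceil_le {y : ℝ} (hy : 0 ≤ y) {b : ℕ} (hb : 1 < b) :
    (b : ℝ) ^ Nat.clog b ⌈y⌉₊ ≤ b * (y + 1) := by
  have hb' : (1 : ℝ) ≤ b := by exact_mod_cast hb.le
  rcases h : Nat.clog b ⌈y⌉₊ with _ | k
  · rw [pow_zero]; nlinarith
  · rw [pow_succ, mul_comm]
    exact mul_le_mul_of_nonneg_left (pow_le_of_lt_clog_ceil hy (by omega)) (by linarith)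

/-- Number of dyadic scales in the box of side `L`. -/
def topScale (K : ℝ) (L : ℕ) : ℕ := Nat.log 2 ⌊(L : ℝ) / (2 * K)⌋₊

/-- Dyadic scale of cubes of side of order `L ^ (1 / (2 * d))`. -/
def mesoScale (d L : ℕ) : ℕ := Nat.log 2 ⌊(L : ℝ) ^ (1 / (2 * d) : ℝ)⌋₊

/-- Dyadic scale at which every cube of the box contains a point. -/
def goodScale (d L : ℕ) : ℕ := Nat.clog (2 ^ d) ⌈(d + 2) * Real.log L⌉₊

/-- Bound on the density of empty dyadic cubes of side `2 ^ k`. -/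
def emptyDensity (d k : ℕ) : ℝ := Real.exp (2 - (2 ^ k) ^ d / (4 * (d + 2)))

lemma eventually_rpow_le_mul_pow {α : ℝ} (hαd : α < d) (a : ℝ) {c : ℝ} (hc : 0 < c) :
    ∀ᶠ y : ℝ in atTop, a * y ^ α ≤ c * y ^ d := by
  have h := ((tendsto_rpow_neg_atTop (sub_pos.2 hαd)).const_mul a).eventually
    (Iic_mem_nhds (by rw [mul_zero]; exact hc))
  filter_upwards [h, eventually_gt_atTop 0] with y hy hy0
  have h1 : y ^ α = y ^ (-(d - α)) * y ^ d := by
    rw [← Real.rpow_natCast, ← Real.rpow_add hy0]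
    congr 1
    ring
  rw [h1, ← mul_assoc]
  exact mul_le_mul_of_nonneg_right hy (by positivity)

lemma summable_levCost_mul_emptyDensity (hd : 2 ≤ d) {α K : ℝ} (hK : 0 < K) (hαd : α < d) :
    Summable fun k => levCost d K α (k + 1) * emptyDensity d k := by
  have hd0 : (0 : ℝ) < d + 2 := by positivity
  set δ : ℝ := 1 / (4 * (d + 2)) with hδ
  have hδ0 : 0 < δ / 3 := by positivity
  have hd1 : ((1 : ℕ) : ℝ) < d := by exact_mod_cast hd
  have h1 := eventually_rpow_le_mul_pow hαd ((16 * d * K) ^ α) hδ0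
  have h2 := eventually_rpow_le_mul_pow (α := 1) (by simpa using hd1) (d * Real.log 4 + 1) hδ0
  have h3 := eventually_rpow_le_mul_pow (d := d) (α := 0) (by positivity) 2 hδ0
  have ht : Tendsto (fun k : ℕ => (2 : ℝ) ^ k) atTop atTop :=
    tendsto_pow_atTop_atTop_of_one_lt (by norm_num)
  refine Summable.of_norm_bounded_eventually_nat (g := fun k : ℕ => Real.exp (-k))
    (Real.summable_exp_neg_nat) ?_
  filter_upwards [ht.eventually h1, ht.eventually h2, ht.eventually h3] with k h1 h2 h3
  have hk : (k : ℝ) + 1 ≤ 2 ^ k := by exact_mod_cast Nat.lt_two_pow_self (n := k)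
  rw [Real.norm_eq_abs, abs_of_nonneg (mul_nonneg (levCost_pos _ _ _ _).le
    (by unfold emptyDensity; positivity))]
  have h4 : (4 : ℝ) ^ (d * (k + 1)) = Real.exp (d * (k + 1) * Real.log 4) := by
    rw [← Real.rpow_natCast, Real.rpow_def_of_pos (by norm_num)]
    push_cast
    congr 1
    ring
  unfold levCost emptyDensity
  rw [h4, ← Real.exp_add, ← Real.exp_add, Real.exp_le_exp]
  have h5 : (8 * d * K * 2 ^ (k + 1) : ℝ) ^ α = (16 * d * K) ^ α * (2 ^ k) ^ α := by
    rw [← Real.mul_rpow (by positivity) (by positivity)]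
    congr 1
    ring
  have h6 : (d : ℝ) * (k + 1) * Real.log 4 ≤ d * Real.log 4 * 2 ^ k := by
    have : 0 ≤ d * Real.log 4 := by positivity
    nlinarith
  have h7 : (((2 : ℝ) ^ k) ^ d) / (4 * (d + 2)) = δ * (2 ^ k) ^ d := by rw [hδ]; ring
  rw [h5, h7]
  rw [Real.rpow_one] at h2
  rw [Real.rpow_zero] at h3
  linarith

lemma eventually_scales (hd : 2 ≤ d) {α K : ℝ} (hα : 0 < α) (hαd : α < d) (hK : 0 < K) :
    ∀ᶠ L : ℕ in atTop, 1 ≤ L ∧ goodScale d L ≤ mesoScale d L ∧ mesoScale d L ≤ topScale K L ∧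
      (2 : ℝ) ^ topScale K L ≤ L / (2 * K) ∧ L / (2 * K) ≤ 2 * 2 ^ topScale K L ∧
      (2 : ℝ) ^ mesoScale d L ≤ (L : ℝ) ^ (1 / (2 * d) : ℝ) ∧
      (L : ℝ) ^ (1 / (2 * d) : ℝ) ≤ 2 * 2 ^ mesoScale d L ∧
      (d + 2) * Real.log L ≤ ((2 : ℝ) ^ goodScale d L) ^ d ∧
      Real.exp ((8 * d * K * 2 ^ goodScale d L) ^ α) ≤ (L : ℝ) ^ (1 / 2 : ℝ) ∧
      goodScale d L ≤ L ∧
      ∀ k < goodScale d L, (d + 3) * Real.log L ≤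
        ((2 : ℝ) ^ (mesoScale d L - k)) ^ d * emptyDensity d k := by
  have hdr : (2 : ℝ) ≤ d := by exact_mod_cast hd
  set η : ℝ := 1 / ((d + 3) * 4 ^ d) with hη
  have hη0 : 0 < η := by positivity
  obtain ⟨y₀, hy₀⟩ := eventually_atTop.1 (eventually_rpow_le_mul_pow hαd ((8 * d * K) ^ α)
    (c := 1 / (2 * 2 ^ d * (d + 3))) (by positivity))
  have hcast : Tendsto (fun L : ℕ => (L : ℝ)) atTop atTop := tendsto_natCast_atTop_atTop
  have hlog : Tendsto (fun L : ℕ => Real.log L) atTop atTop := Real.tendsto_log_atTop.comp hcast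
  have hlo := ((isLittleO_log_rpow_atTop (r := 1 / 8) (by norm_num)).comp_tendsto hcast).bound hη0
  have hK4 : ∀ᶠ L : ℕ in atTop, 4 * K ≤ (L : ℝ) ^ (1 / 2 : ℝ) :=
    ((tendsto_rpow_atTop (by norm_num)).comp hcast).eventually_ge_atTop _
  filter_upwards [hlo, hK4, hlog.eventually_ge_atTop 1, hlog.eventually_ge_atTop (|y₀| ^ d),
    eventually_ge_atTop 1] with L hlo hK4 hlog1 hlogy hL1
  set t := Real.log L with ht
  have hL1r : (1 : ℝ) ≤ L := by exact_mod_cast hL1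
  have hL0 : (0 : ℝ) < L := by linarith
  have hexp : ∀ s : ℝ, (L : ℝ) ^ s = Real.exp (t * s) := fun s => Real.rpow_def_of_pos hL0 s
  simp only [Function.comp, Real.norm_eq_abs] at hlo
  rw [abs_of_nonneg (by linarith), abs_of_nonneg (Real.rpow_nonneg hL0.le _)] at hlo
  set ε : ℝ := 1 / (2 * d) with hε
  have hεle : ε ≤ 1 / 2 := by
    rw [hε, div_le_div_iff₀ (by positivity) (by norm_num)]; linarith
  have hε0 : 0 ≤ ε := by positivity
  have hLε1 : 1 ≤ (L : ℝ) ^ ε := Real.one_le_rpow hL1r hε0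
  have hLεd : ((L : ℝ) ^ ε) ^ d = (L : ℝ) ^ (1 / 2 : ℝ) := by
    rw [← Real.rpow_natCast, ← Real.rpow_mul hL0.le]
    congr 1
    rw [hε]
    field_simp
  have hhalf : (L : ℝ) ^ (1 / 2 : ℝ) * (L : ℝ) ^ (1 / 2 : ℝ) = L := by
    rw [← Real.rpow_add hL0]; norm_num
  have hhalf1 : 1 ≤ (L : ℝ) ^ (1 / 2 : ℝ) := Real.one_le_rpow hL1r (by norm_num)
  have hLK : 1 ≤ (L : ℝ) / (2 * K) := by
    rw [le_div_iff₀ (by positivity)]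
    nlinarith
  obtain ⟨hJ1, hJ2⟩ := pow_log_floor hLK
  obtain ⟨hκ1, hκ2⟩ := pow_log_floor hLε1
  have hb : 1 < 2 ^ d := Nat.one_lt_two_pow (by omega)
  have hy : 0 ≤ (d + 2) * t := by positivity
  have hm1 := le_pow_clog_ceil ((d + 2) * t) hb
  have hm2 := pow_clog_ceil_le hy hb
  have hm3 : ∀ k < goodScale d L, _ := fun k hk => pow_le_of_lt_clog_ceil hy hk
  change _ ≤ _ ^ goodScale d L at hm1
  change _ ^ goodScale d L ≤ _ at hm2
  have hsw : ∀ k, (((2 ^ d : ℕ) : ℝ)) ^ k = (2 ^ k) ^ d := fun k => by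
    push_cast; rw [← pow_mul, ← pow_mul, mul_comm]
  simp only [hsw] at hm1 hm2 hm3
  push_cast at hm2
  change (2 : ℝ) ^ topScale K L ≤ _ at hJ1
  change _ ≤ 2 * (2 : ℝ) ^ topScale K L at hJ2
  change (2 : ℝ) ^ mesoScale d L ≤ _ at hκ1
  change _ ≤ 2 * (2 : ℝ) ^ mesoScale d L at hκ2
  set J := topScale K L
  set κ := mesoScale d L
  set m := goodScale d L
  have h18 : (L : ℝ) ^ (1 / 8 : ℝ) ≤ (L : ℝ) ^ (1 / 2 : ℝ) :=
    Real.rpow_le_rpow_of_exponent_le hL1r (by norm_num)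
  have h44 : (4 : ℝ) ^ d = 2 ^ d * 2 ^ d := by rw [← mul_pow]; norm_num
  have h2d : (1 : ℝ) ≤ 2 ^ d := one_le_pow₀ (by norm_num)
  have hlo' : 2 ^ d * 2 ^ d * ((d + 3) * t) ≤ (L : ℝ) ^ (1 / 8 : ℝ) := by
    rw [hη, div_mul_eq_mul_div, one_mul, le_div_iff₀ (by positivity), h44] at hlo
    linarith
  have hκd : (L : ℝ) ^ (1 / 2 : ℝ) ≤ 2 ^ d * (2 ^ κ) ^ d := by
    rw [← hLεd, ← mul_pow]
    exact pow_le_pow_left₀ (by positivity) hκ2 d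
  have hmd : ((2 : ℝ) ^ m) ^ d ≤ 2 ^ d * ((d + 3) * t) :=
    hm2.trans (by gcongr; linarith)
  have hmκ : m ≤ κ := by
    have h1 : ((2 : ℝ) ^ m) ^ d ≤ (2 ^ κ) ^ d := by
      have h2 : (2 : ℝ) ^ d * (2 ^ m) ^ d ≤ 2 ^ d * (2 ^ κ) ^ d := by
        have := mul_le_mul_of_nonneg_left hmd (by positivity : (0 : ℝ) ≤ 2 ^ d)
        linarith
      exact le_of_mul_le_mul_left h2 (by positivity)
    have h2 := le_of_pow_le_pow_left₀ (by omega) (by positivity) h1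
    exact (pow_le_pow_iff_right₀ (by norm_num)).1 h2
  have hκJ : κ ≤ J := by
    have h1 : (2 : ℝ) ^ κ ≤ 2 ^ J := by
      have h2 : (L : ℝ) ^ ε ≤ (L : ℝ) ^ (1 / 2 : ℝ) :=
        Real.rpow_le_rpow_of_exponent_le hL1r hεle
      have h3 : (L : ℝ) ^ (1 / 2 : ℝ) * (4 * K) ≤ L := by
        calc _ ≤ (L : ℝ) ^ (1 / 2 : ℝ) * (L : ℝ) ^ (1 / 2 : ℝ) := by gcongr
          _ = L := hhalf
      rw [div_le_iff₀ (by positivity)] at hJ2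
      have h4 : (L : ℝ) ^ (1 / 2 : ℝ) * (4 * K) ≤ 2 ^ J * (4 * K) := by linarith
      exact hκ1.trans (h2.trans (le_of_mul_le_mul_right h4 (by positivity)))
    exact (pow_le_pow_iff_right₀ (by norm_num)).1 h1
  refine ⟨hL1, hmκ, hκJ, hJ1, hJ2, hκ1, hκ2, hm1, ?_, ?_, ?_⟩
  · have hy1 : y₀ ≤ 2 ^ m := by
      refine (le_abs_self _).trans (le_of_pow_le_pow_left₀ (n := d) (by omega) (by positivity) ?_)
      refine hlogy.trans (le_trans ?_ hm1)
      nlinarith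
    have h1 := hy₀ _ hy1
    rw [hexp, Real.exp_le_exp, Real.mul_rpow (by positivity) (by positivity)]
    refine h1.trans ?_
    calc 1 / (2 * 2 ^ d * ((d : ℝ) + 3)) * (2 ^ m) ^ d
        ≤ 1 / (2 * 2 ^ d * (d + 3)) * (2 ^ d * ((d + 3) * t)) := by gcongr
      _ = t * (1 / 2) := by field_simp
  · have h1 : (m : ℝ) ≤ 2 ^ m := by exact_mod_cast (Nat.lt_two_pow_self (n := m)).le
    have h2 : (2 : ℝ) ^ m ≤ (2 ^ m) ^ d :=
      le_self_pow₀ (one_le_pow₀ (by norm_num)) (by omega)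
    have h3 : (m : ℝ) ≤ L := by
      have : 2 ^ d * ((d + 3) * t) ≤ 2 ^ d * (2 ^ d * ((d + 3) * t)) :=
        le_mul_of_one_le_left (by positivity) h2d
      nlinarith
    exact_mod_cast h3
  · intro k hk
    have h1 := hm3 k hk
    have hkt : ((2 : ℝ) ^ k) ^ d ≤ (d + 3) * t := h1.trans (by linarith)
    have h2 : ((2 : ℝ) ^ κ) ^ d = (2 ^ (κ - k)) ^ d * (2 ^ k) ^ d := by
      rw [← mul_pow, ← pow_add]
      congr 2
      omega
    have h3 : (L : ℝ) ^ (-(1 / 4) : ℝ) ≤ emptyDensity d k := by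
      rw [hexp, emptyDensity, Real.exp_le_exp]
      have : ((2 : ℝ) ^ k) ^ d / (4 * (d + 2)) ≤ ((d + 2) * t + 1) / (4 * (d + 2)) := by gcongr
      have h4 : ((d + 2) * t + 1) / (4 * ((d : ℝ) + 2)) = t * (1 / 4) + 1 / (4 * (d + 2)) := by
        field_simp
      have h5 : 1 / (4 * ((d : ℝ) + 2)) ≤ 1 := by
        rw [div_le_one (by positivity)]; linarith
      linarith
    have h4 : (L : ℝ) ^ (1 / 2 : ℝ) * (L : ℝ) ^ (-(1 / 4) : ℝ) =
        (L : ℝ) ^ (1 / 8 : ℝ) * (L : ℝ) ^ (1 / 8 : ℝ) := by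
      rw [← Real.rpow_add hL0, ← Real.rpow_add hL0]; norm_num
    set q := (L : ℝ) ^ (1 / 8 : ℝ)
    set N : ℝ := (2 ^ (κ - k)) ^ d
    have hN0 : 0 < N := by positivity
    have hE0 : 0 < emptyDensity d k := Real.exp_pos _
    have h5 : q * q ≤ 2 ^ d * (N * emptyDensity d k) * ((d + 3) * t) := by
      rw [← h4]
      calc _ ≤ (2 ^ d * (N * (2 ^ k) ^ d)) * emptyDensity d k := by
            rw [← h2]; gcongr
        _ = 2 ^ d * (N * emptyDensity d k) * (2 ^ k) ^ d := by ring
        _ ≤ _ := by gcongr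
    have hA : 0 < (d + 3) * t := by positivity
    have h6 : 2 ^ d * ((d + 3) * t) * ((d + 3) * t) ≤
        2 ^ d * (N * emptyDensity d k) * ((d + 3) * t) := by
      refine le_trans ?_ h5
      have h7 : (2 ^ d * 2 ^ d * ((d + 3) * t)) * (2 ^ d * 2 ^ d * ((d + 3) * t)) ≤ q * q :=
        mul_le_mul hlo' hlo' (by positivity) (by positivity)
      refine le_trans ?_ h7
      have h8 : (1 : ℝ) ≤ 2 ^ d * 2 ^ d * 2 ^ d := by
        have := one_le_mul_of_one_le_of_one_le h2d h2d
        exact one_le_mul_of_one_le_of_one_le this h2d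
      calc 2 ^ d * ((d + 3) * t) * ((d + 3) * t) = 1 * (2 ^ d * ((d + 3) * t) * ((d + 3) * t)) := by
            ring
        _ ≤ (2 ^ d * 2 ^ d * 2 ^ d) * (2 ^ d * ((d + 3) * t) * ((d + 3) * t)) := by gcongr
        _ = _ := by ring
    have h9 := le_of_mul_le_mul_right h6 hA
    exact le_of_mul_le_mul_left h9 (by positivity)

/-- Almost surely, all sets of cubes in a family of summable weight eventually contain a
nonempty cube. -/
def HitsSummableFamilies (P : Measure (Config d)) (K : ℝ) : Prop :=
  ∀ (ι : Type) (I : ℕ → Finset ι) (S : ℕ → ι → Finset (Fin d → ℤ)) (c : ℝ),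
    (∀ᶠ L : ℕ in atTop, ∑ i ∈ I L, Real.exp (-(S L i).card) ≤ c * (1 / (L : ℝ) ^ 2)) →
    ∀ᵐ ξ ∂P, ∀ᶠ L in atTop, ∀ i ∈ I L, ∃ x ∈ S L i, (ξ ∩ Kcube d K x).Nonempty

lemma exists_hitsSummableFamilies {P : Measure (Config d)} (hP : IsPointProcess P)
    (hA1 : AssumptionA1 P) : ∃ K : ℝ, 0 < K ∧ HitsSummableFamilies P K := by
  have he : Real.exp (-1) < 1 := by simp
  obtain ⟨K, hK, μ, ν, -, hν, hfst, hsnd, hμ⟩ := hA1 (1 - Real.exp (-1)) (by linarith)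
    (by linarith [Real.exp_pos (-1)])
  refine ⟨K, hK, fun ι I S c hc => ?_⟩
  obtain ⟨L₀, hL₀⟩ := eventually_atTop.1 hc
  have h := ae_eventually_exists_nonempty hP hK hν hfst hsnd hμ
    (fun L => if L₀ ≤ L then I L else ∅) S ?_
  · filter_upwards [h] with ξ hξ
    filter_upwards [hξ, eventually_ge_atTop L₀] with L hL hL0
    rwa [if_pos hL0] at hL
  · have hs : Summable fun L : ℕ => |c| * (1 / (L : ℝ) ^ 2) :=
      (Real.summable_one_div_nat_pow.2 (by norm_num)).mul_left _
    refine ne_top_of_le_ne_top hs.tsum_ofReal_ne_top (ENNReal.tsum_le_tsum fun L => ?_)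
    split_ifs with h
    · rw [← ENNReal.ofReal_sum_of_nonneg fun _ _ => (Real.exp_pos _).le]
      refine ENNReal.ofReal_le_ofReal ((hL₀ L h).trans ?_)
      exact mul_le_mul_of_nonneg_right (le_abs_self c) (by positivity)
    · simp

lemma choose_le_exp_div_pow {N j : ℕ} {β : ℝ} (hβ : 0 < β) (hj : N * β ≤ j) :
    (N.choose j : ℝ) ≤ (Real.exp 1 / β) ^ j := by
  calc (N.choose j : ℝ) ≤ N ^ j / j.factorial := Nat.choose_le_pow_div j N
    _ ≤ (j / β) ^ j / j.factorial := by
        gcongr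
        rwa [le_div_iff₀ hβ]
    _ = (1 / β) ^ j * ((j : ℝ) ^ j / j.factorial) := by rw [div_pow, div_pow]; ring
    _ ≤ (1 / β) ^ j * Real.exp j := by
        gcongr
        exact Real.pow_div_factorial_le_exp j (by positivity) j
    _ = _ := by
        rw [← mul_one (j : ℝ), Real.exp_nat_mul, ← mul_pow]
        congr 1
        ring

lemma exp_neg_mul_log_le {L n : ℕ} {y : ℝ} (hL : 1 ≤ L) (h : n * Real.log L ≤ y) :
    Real.exp (-y) ≤ 1 / (L : ℝ) ^ n := by
  have hL0 : (0 : ℝ) < L := by exact_mod_cast hL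
  calc Real.exp (-y) ≤ Real.exp (-(n * Real.log L)) := Real.exp_le_exp.2 (neg_le_neg h)
    _ = _ := by
        rw [Real.exp_neg, mul_comm, Real.exp_mul, Real.exp_log hL0, Real.rpow_natCast, one_div]

/-- Side of the cells of the box of side `L`. -/
def cellSide (K : ℝ) (L : ℕ) : ℝ := L / 2 ^ topScale K L

lemma two_mul_le_cellSide {K : ℝ} {L : ℕ} (hK : 0 < K)
    (h : (2 : ℝ) ^ topScale K L ≤ L / (2 * K)) : 2 * K ≤ cellSide K L := by
  rw [le_div_iff₀ (by positivity)] at h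
  rw [cellSide, le_div_iff₀ (by positivity)]
  linarith

lemma cellSide_le {K : ℝ} {L : ℕ} (hK : 0 < K)
    (h : L / (2 * K) ≤ 2 * 2 ^ topScale K L) : cellSide K L ≤ 4 * K := by
  rw [div_le_iff₀ (by positivity)] at h
  rw [cellSide, div_le_iff₀ (by positivity)]
  linarith

lemma card_grid_le_of_le_topScale {K : ℝ} {L k : ℕ} (h : (2 : ℝ) ^ topScale K L ≤ L / (2 * K)) :
    ((grid d (2 ^ (topScale K L - k))).card : ℝ) ≤ (1 / (2 * K)) ^ d * (L : ℝ) ^ d := by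
  rw [card_grid, ← mul_pow]
  push_cast
  refine pow_le_pow_left₀ (by positivity) (le_trans ?_ (h.trans (le_of_eq (by ring)))) d
  exact pow_le_pow_right₀ (by norm_num) (Nat.sub_le _ _)

lemma ae_eventually_nonempty_goodScale (hd : 2 ≤ d) {α K : ℝ} (hα : 0 < α) (hαd : α < d)
    (hK : 0 < K) {P : Measure (Config d)} (h : HitsSummableFamilies P K) :
    ∀ᵐ ξ ∂P, ∀ᶠ L : ℕ in atTop, ∀ b ∈ grid d (2 ^ (topScale K L - goodScale d L)),
      ∃ c ∈ grid d (2 ^ goodScale d L), (ξ ∩ Kcube d K (boxIdx L (cellSide K L) K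
        (site (2 ^ goodScale d L) b c))).Nonempty := by
  classical
  have h' := h (Fin d → ℕ) (fun L => grid d (2 ^ (topScale K L - goodScale d L)))
    (fun L b => (grid d (2 ^ goodScale d L)).image fun c =>
      boxIdx L (cellSide K L) K (site (2 ^ goodScale d L) b c)) ((1 / (2 * K)) ^ d) ?_
  · filter_upwards [h'] with ξ hξ
    filter_upwards [hξ] with L hL b hb
    obtain ⟨x, hx, hn⟩ := hL b hb
    obtain ⟨c, hc, rfl⟩ := Finset.mem_image.1 hx
    exact ⟨c, hc, hn⟩
  · filter_upwards [eventually_scales hd hα hαd hK] with L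
      ⟨hL1, _, _, hJ1, _, _, _, hm, _, _, _⟩
    have hL0 : (0 : ℝ) < L := by exact_mod_cast hL1
    have hℓ := two_mul_le_cellSide hK hJ1
    calc _ ≤ ∑ b ∈ grid d (2 ^ (topScale K L - goodScale d L)), 1 / (L : ℝ) ^ (d + 2) := by
          refine Finset.sum_le_sum fun b _ => exp_neg_mul_log_le hL1 ?_
          rw [Finset.card_image_of_injective _ fun c c' hc =>
            site_injective _ b (boxIdx_injective hK hℓ hc), card_grid]
          push_cast
          exact hm
      _ = (grid d (2 ^ (topScale K L - goodScale d L))).card * (1 / (L : ℝ) ^ (d + 2)) := by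
          rw [Finset.sum_const, nsmul_eq_mul]
      _ ≤ (1 / (2 * K)) ^ d * (L : ℝ) ^ d * (1 / (L : ℝ) ^ (d + 2)) := by
          gcongr
          exact card_grid_le_of_le_topScale hJ1
      _ = _ := by
          rw [pow_add]
          field_simp

lemma choose_mul_exp_le (hd : 1 ≤ d) (κ k : ℕ) :
    ((((2 ^ (κ - k)) ^ d).choose ⌈((2 : ℝ) ^ (κ - k)) ^ d * emptyDensity d k⌉₊ : ℕ) : ℝ) *
      Real.exp (-(⌈((2 : ℝ) ^ (κ - k)) ^ d * emptyDensity d k⌉₊ * (2 ^ k) ^ d)) ≤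
      Real.exp (-(((2 : ℝ) ^ (κ - k)) ^ d * emptyDensity d k)) := by
  set y := ((2 : ℝ) ^ (κ - k)) ^ d * emptyDensity d k with hy
  set j := ⌈y⌉₊ with hj
  have hyj : y ≤ j := Nat.le_ceil y
  set w : ℝ := (2 ^ k) ^ d with hw
  have hw0 : 0 ≤ w := by positivity
  have h1 := choose_le_exp_div_pow (N := (2 ^ (κ - k)) ^ d) (j := j)
    (β := emptyDensity d k) (Real.exp_pos _) (by push_cast; exact hyj)
  have h2 : (Real.exp 1 / emptyDensity d k) ^ j =
      Real.exp (j * (w / (4 * (d + 2)) - 1)) := by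
    rw [emptyDensity, ← Real.exp_sub, ← Real.exp_nat_mul]
    congr 1
    ring
  rw [h2] at h1
  refine (mul_le_mul_of_nonneg_right h1 (Real.exp_pos _).le).trans ?_
  rw [← Real.exp_add, Real.exp_le_exp]
  have h3 : w / (4 * (d + 2)) ≤ w := div_le_self hw0 (by
    have : (0 : ℝ) ≤ d := by positivity
    linarith)
  have h4 : (0 : ℝ) ≤ j := by positivity
  nlinarith [mul_le_mul_of_nonneg_left h3 h4]

lemma ae_eventually_nonempty_of_card (hd : 2 ≤ d) {α K : ℝ} (hα : 0 < α) (hαd : α < d)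
    (hK : 0 < K) {P : Measure (Config d)} (h : HitsSummableFamilies P K) :
    ∀ᵐ ξ ∂P, ∀ᶠ L : ℕ in atTop, ∀ v ∈ grid d (2 ^ (topScale K L - mesoScale d L)),
      ∀ k < goodScale d L, ∀ T ∈ (grid d (2 ^ (mesoScale d L - k))).powersetCard
        ⌈((2 : ℝ) ^ (mesoScale d L - k)) ^ d * emptyDensity d k⌉₊,
      ∃ b ∈ T, ∃ c ∈ grid d (2 ^ k), (ξ ∩ Kcube d K (boxIdx L (cellSide K L) K
        (site (2 ^ mesoScale d L) v (site (2 ^ k) b c)))).Nonempty := by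
  classical
  have h' := h (Σ _ : (Fin d → ℕ) × ℕ, Finset (Fin d → ℕ))
    (fun L => (grid d (2 ^ (topScale K L - mesoScale d L)) ×ˢ
      Finset.range (goodScale d L)).sigma fun p =>
        (grid d (2 ^ (mesoScale d L - p.2))).powersetCard
          ⌈((2 : ℝ) ^ (mesoScale d L - p.2)) ^ d * emptyDensity d p.2⌉₊)
    (fun L p => (p.2 ×ˢ grid d (2 ^ p.1.2)).image fun q =>
      boxIdx L (cellSide K L) K (site (2 ^ mesoScale d L) p.1.1 (site (2 ^ p.1.2) q.1 q.2)))
    ((1 / (2 * K)) ^ d) ?_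
  · filter_upwards [h'] with ξ hξ
    filter_upwards [hξ] with L hL v hv k hk T hT
    obtain ⟨x, hx, hn⟩ := hL ⟨(v, k), T⟩ (Finset.mem_sigma.2
      ⟨Finset.mem_product.2 ⟨hv, Finset.mem_range.2 hk⟩, hT⟩)
    obtain ⟨q, hq, rfl⟩ := Finset.mem_image.1 hx
    obtain ⟨hq1, hq2⟩ := Finset.mem_product.1 hq
    exact ⟨q.1, hq1, q.2, hq2, hn⟩
  · filter_upwards [eventually_scales hd hα hαd hK] with L
      ⟨hL1, _, _, hJ1, _, _, _, _, _, hmL, hk⟩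
    have hL0 : (0 : ℝ) < L := by exact_mod_cast hL1
    have hℓ := two_mul_le_cellSide hK hJ1
    rw [Finset.sum_sigma, Finset.sum_product]
    calc _ ≤ ∑ v ∈ grid d (2 ^ (topScale K L - mesoScale d L)),
          ∑ k ∈ Finset.range (goodScale d L), 1 / (L : ℝ) ^ (d + 3) := by
          refine Finset.sum_le_sum fun v _ => Finset.sum_le_sum fun k hkm => ?_
          refine le_trans (le_trans (le_of_eq ?_) (choose_mul_exp_le (d := d) (by omega)
            (mesoScale d L) k)) (exp_neg_mul_log_le hL1 (by
              push_cast; exact hk k (Finset.mem_range.1 hkm)))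
          rw [Finset.sum_congr rfl (g := fun _ => Real.exp
            (-(⌈((2 : ℝ) ^ (mesoScale d L - k)) ^ d * emptyDensity d k⌉₊ * (2 ^ k) ^ d))),
            Finset.sum_const, Finset.card_powersetCard, card_grid, nsmul_eq_mul]
          intro T hT
          rw [Finset.card_image_of_injOn, Finset.card_product, card_grid,
            (Finset.mem_powersetCard.1 hT).2]
          · push_cast; rfl
          · intro q hq q' hq' hqq
            have hq2 := (Finset.mem_product.1 (Finset.mem_coe.1 hq)).2
            have hq2' := (Finset.mem_product.1 (Finset.mem_coe.1 hq')).2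
            have h1 := site_injective _ _ (boxIdx_injective hK hℓ hqq)
            have h2 : q.1 = q'.1 := funext fun i => by
              rw [← site_div (v := q.1) hq2 i, ← site_div (v := q'.1) hq2' i, h1]
            rw [h2] at h1
            exact Prod.ext h2 (site_injective _ _ h1)
      _ = (grid d (2 ^ (topScale K L - mesoScale d L))).card *
          ((goodScale d L : ℝ) * (1 / (L : ℝ) ^ (d + 3))) := by
          simp only [Finset.sum_const, Finset.card_range, nsmul_eq_mul]
      _ ≤ (1 / (2 * K)) ^ d * (L : ℝ) ^ d * ((L : ℝ) * (1 / (L : ℝ) ^ (d + 3))) := by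
          gcongr
          exact card_grid_le_of_le_topScale hJ1
      _ = _ := by
          rw [pow_add]
          field_simp

/-- The constant of the Poincaré inequality, in terms of the total cost `S` of the paths and the
density `C` of the jump rates. -/
def poincareConst (d : ℕ) (K S C : ℝ) : ℝ :=
  2 * (3 * ((((⌈4 * K⌉₊ + 2 : ℕ) : ℝ) ^ d * C * 2 ^ d) +
    d ^ 2 * (3 * S) * (((⌈4 * K⌉₊ + 2 : ℕ) : ℝ) ^ d * C * 2 ^ d) * 2 +
    4 * d ^ 2 * (3 * S) * (((⌈4 * K⌉₊ + 2 : ℕ) : ℝ) ^ d * C * 2 ^ d) * 2 * (1 / (2 * K)) ^ 2))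

lemma poincareConst_pos (d : ℕ) {K S C : ℝ} (hK : 0 < K) (hS : 0 ≤ S) (hC : 0 < C) :
    0 < poincareConst d K S C := by
  unfold poincareConst
  positivity

lemma gammaP_le_mul_sq (hd : 2 ≤ d) {α K : ℝ} (hα : 0 < α) (hK : 0 < K) {L : ℕ} {S C : ℝ}
    (hS : 0 ≤ S) (hC : 0 ≤ C) (hL1 : 1 ≤ L)
    (hmκ : goodScale d L ≤ mesoScale d L) (hκJ : mesoScale d L ≤ topScale K L)
    (hJ1 : (2 : ℝ) ^ topScale K L ≤ L / (2 * K)) (hJ2 : L / (2 * K) ≤ 2 * (2 : ℝ) ^ topScale K L)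
    (hκ1 : (2 : ℝ) ^ mesoScale d L ≤ (L : ℝ) ^ (1 / (2 * d) : ℝ))
    (hκ2 : (L : ℝ) ^ (1 / (2 * d) : ℝ) ≤ 2 * 2 ^ mesoScale d L)
    (hQ : Real.exp ((8 * d * K * 2 ^ goodScale d L) ^ α) ≤ (L : ℝ) ^ (1 / 2 : ℝ))
    (hSsum : levCost d K α 0 + ∑ k ∈ Finset.range (goodScale d L),
      levCost d K α (k + 1) * emptyDensity d k ≤ S)
    {ξ : Config d} (hfin : (ξ ∩ cube d L).Finite) (i : ℕ)
    (hgood : ∀ b ∈ grid d (2 ^ (topScale K L - goodScale d L)),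
      ∃ c ∈ grid d (2 ^ goodScale d L), (ξ ∩ Kcube d K (boxIdx L (cellSide K L) K
        (site (2 ^ goodScale d L) b c))).Nonempty)
    (hbad : ∀ v ∈ grid d (2 ^ (topScale K L - mesoScale d L)),
      ∀ k < goodScale d L, ∀ T ∈ (grid d (2 ^ (mesoScale d L - k))).powersetCard
        ⌈((2 : ℝ) ^ (mesoScale d L - k)) ^ d * emptyDensity d k⌉₊,
      ∃ b ∈ T, ∃ c ∈ grid d (2 ^ k), (ξ ∩ Kcube d K (boxIdx L (cellSide K L) K
        (site (2 ^ mesoScale d L) v (site (2 ^ k) b c)))).Nonempty)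
    (hA2 : ∀ x : Fin d → ℤ, (Vcube d L (1 / (2 * d)) x ∩ cube d L).Nonempty →
      Rfun α (Vcube d L (1 / (2 * d)) x) ξ ≤
        ENNReal.ofReal (C * (L : ℝ) ^ (1 / (2 * d) * d : ℝ))) :
    gammaP α hfin.toFinset i ≤ ENNReal.ofReal (poincareConst d K S C * (L : ℝ) ^ 2) := by
  have hL1' : (1 : ℝ) ≤ L := by exact_mod_cast hL1
  have hL0 : (0 : ℝ) < L := by linarith
  have hd0 : (0 : ℝ) < d := by exact_mod_cast (by omega : 0 < d)
  have hℓ1 := two_mul_le_cellSide hK hJ1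
  have hℓ2 := cellSide_le hK hJ2
  have hLN : (L : ℝ) = cellSide K L * (2 ^ topScale K L : ℕ) := by
    rw [cellSide]
    push_cast
    field_simp
  set B : ℝ := ((⌈4 * K⌉₊ + 2 : ℕ) : ℝ) ^ d * C * 2 ^ d with hB
  have hB0 : 0 ≤ B := by positivity
  have hcell : (2 : ℝ) ^ mesoScale d L * cellSide K L ≤ 4 * K * (L : ℝ) ^ (1 / (2 * d) : ℝ) := by
    rw [mul_comm]
    exact mul_le_mul hℓ2 hκ1 (by positivity) (by positivity)
  have hmeso : ((2 : ℝ) ^ mesoScale d L) ^ d ≤ (L : ℝ) ^ (1 / 2 : ℝ) := by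
    refine (pow_le_pow_left₀ (by positivity) hκ1 d).trans (le_of_eq ?_)
    rw [← Real.rpow_natCast, ← Real.rpow_mul hL0.le]
    congr 1
    field_simp
  have hhalf : (L : ℝ) ^ (1 / 2 : ℝ) * (L : ℝ) ^ (1 / 2 : ℝ) ≤ (L : ℝ) ^ 2 := by
    rw [← Real.rpow_add hL0, add_halves, Real.rpow_one]
    nlinarith
  refine (gammaP_le_of_good (S := S) (B := B) (Q := (L : ℝ) ^ (1 / 2 : ℝ)) (by omega) hα hK hmκ
    hκJ hLN hℓ1 hℓ2 ξ hfin
    (fun k => ((2 : ℝ) ^ (mesoScale d L - k)) ^ d * emptyDensity d k) i hgood hbad ?_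
    (fun v _ => sum_rate_block_le hL1 hK hLN (by linarith) hcell hκ2 hC hfin hA2 v)
    hB0 hS hQ).trans (ENNReal.ofReal_le_ofReal ?_)
  · rw [mul_comm S]
    refine le_trans (le_of_eq ?_) (mul_le_mul_of_nonneg_left hSsum (by positivity))
    rw [mul_add, Finset.mul_sum]
    refine congrArg _ (Finset.sum_congr rfl fun k hk => ?_)
    have h2 : (2 : ℝ) ^ mesoScale d L = 2 ^ k * 2 ^ (mesoScale d L - k) := by
      rw [← pow_add, Nat.add_sub_cancel' ((Finset.mem_range.1 hk).le.trans hmκ)]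
    rw [h2, mul_pow]
    ring
  · have h1 : ((2 : ℝ) ^ mesoScale d L) ^ d * (L : ℝ) ^ (1 / 2 : ℝ) ≤ (L : ℝ) ^ 2 :=
      (mul_le_mul_of_nonneg_right hmeso (by positivity)).trans hhalf
    have h2 : ((2 : ℝ) ^ mesoScale d L) ^ d * ((2 : ℝ) ^ mesoScale d L) ^ d ≤ (L : ℝ) ^ 2 :=
      (mul_le_mul hmeso hmeso (by positivity) (by positivity)).trans hhalf
    have h3 : ((2 : ℝ) ^ topScale K L) ^ 2 ≤ (1 / (2 * K)) ^ 2 * (L : ℝ) ^ 2 := by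
      rw [← mul_pow]
      exact pow_le_pow_left₀ (by positivity) (hJ1.trans (le_of_eq (by ring))) 2
    calc _ ≤ 2 * (3 * (B * (L : ℝ) ^ 2 + d ^ 2 * (3 * S) * B * 2 * (L : ℝ) ^ 2 +
          4 * d ^ 2 * (3 * S) * B * 2 * ((1 / (2 * K)) ^ 2 * (L : ℝ) ^ 2))) := by
          rw [mul_assoc B]
          gcongr
      _ = _ := by
          rw [poincareConst, ← hB]
          ring

/-- Poincaré inequality (1.16): `γ^i(L) ≤ C L²` a.s. eventually. -/
theorem stmt_1 (hd : 2 ≤ d) (α : ℝ) (hα0 : 0 < α) (hαd : α < d)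
    (P : Measure (Config d)) (hP : IsPointProcess P)
    (hA1 : AssumptionA1 P) (hA2 : AssumptionA2 α P) :
    ∃ C : ℝ, 0 < C ∧ ∀ i ∈ ({1, 2, 3} : Set ℕ),
      ∀ᵐ ξ ∂P, ∀ᶠ L : ℕ in atTop, ∀ hfin : (ξ ∩ cube d L).Finite,
        gammaP α hfin.toFinset i ≤ ENNReal.ofReal (C * (L : ℝ) ^ 2) := by
  have hd2 : (2 : ℝ) ≤ d := by exact_mod_cast hd
  obtain ⟨K, hK, hhit⟩ := exists_hitsSummableFamilies hP hA1
  obtain ⟨C, hC, hC2⟩ := hA2 (1 / (2 * d)) (by positivity) (by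
    rw [div_lt_one (by positivity)]
    linarith)
  have hsum := summable_levCost_mul_emptyDensity hd hK hαd
  have hterm : ∀ k, 0 ≤ levCost d K α (k + 1) * emptyDensity d k := fun k =>
    mul_nonneg (levCost_pos d K α _).le (Real.exp_pos _).le
  have hS := add_nonneg (levCost_pos d K α 0).le (tsum_nonneg (L := .unconditional ℕ) hterm)
  refine ⟨_, poincareConst_pos d hK hS hC, fun i _ => ?_⟩
  filter_upwards [ae_eventually_nonempty_goodScale hd hα0 hαd hK hhit,
    ae_eventually_nonempty_of_card hd hα0 hαd hK hhit, hC2] with ξ h1 h2 h3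
  filter_upwards [h1, h2, h3, eventually_scales hd hα0 hαd hK] with L hgood hbad hR
    ⟨hL1, hmκ, hκJ, hJ1, hJ2, hκ1, hκ2, _, hQ, _, _⟩ hfin
  exact gammaP_le_mul_sq hd hα0 hK hS hC.le hL1 hmκ hκJ hJ1 hJ2 hκ1 hκ2 hQ
    (add_le_add le_rfl (hsum.sum_le_tsum _ fun k _ => hterm k)) hfin i hgood hbad hR

end
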